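/- Let T be a complete first-order theory with infinite models in a countable language L, let M be an ℵ₁-saturated model of T, and suppose there exists a simple type p ∈ S₁(T). Then T has exactly 2^ℵ₀ countably infinite models up to isomorphism. -/

import Mathlib

open FirstOrder FirstOrder.Language Set Cardinal

universe u v w

namespace PaperDef

variable {L : FirstOrder.Language.{u, v}}

/-- Valuation assigning parameters from `A` their own values and the
`n` free variables the values given by the tuple `x`. -/
def pval {M : Type w} {A : Set M} {n : ℕ} (x : Fin n → M) : ↥A ⊕ Fin n → M :=
  Sum.elim Subtype.val x

variable {M : Type w} [L.Structure M]

/-- The subset of `M` defined by an `L(A)`-formula in one free variable. -/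
def defSet (A : Set M) (δ : L.Formula (↥A ⊕ Fin 1)) : Set M :=
  {a | δ.Realize (pval ![a])}

/-- The binary relation on `M` defined by an `L(A)`-formula in two free variables. -/
def defRel (A : Set M) (φ : L.Formula (↥A ⊕ Fin 2)) : M → M → Prop :=
  fun a b => φ.Realize (pval ![a, b])

/-- The relation defined by `φ`, guarded so as to only hold on the set defined by `δ`
(the paper's convention of writing `x < y` for `x ∈ D ∧ y ∈ D ∧ x < y`). -/
def gRel (A : Set M) (δ : L.Formula (↥A ⊕ Fin 1)) (φ : L.Formula (↥A ⊕ Fin 2)) :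
    M → M → Prop :=
  fun a b => a ∈ defSet A δ ∧ b ∈ defSet A δ ∧ defRel A φ a b

/-- The set of realizations in `M` of a set of `L(A)`-formulas in one free variable. -/
def typeSet (A : Set M) (p : Set (L.Formula (↥A ⊕ Fin 1))) : Set M :=
  {a | ∀ φ ∈ p, φ.Realize (pval ![a])}

/-- A set of `L(A)`-formulas in `n` free variables is finitely satisfiable in `M`. -/
def FinSat (A : Set M) {n : ℕ} (p : Set (L.Formula (↥A ⊕ Fin n))) : Prop :=
  ∀ s : Finset (L.Formula (↥A ⊕ Fin n)), ↑s ⊆ p →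
    ∃ x : Fin n → M, ∀ φ ∈ s, Formula.Realize φ (pval x)

/-- A complete `n`-type over `A` (relative to the complete theory of `M` with
parameters in `A`): a maximal finitely satisfiable set of formulas. -/
def IsCompleteType (A : Set M) {n : ℕ} (p : Set (L.Formula (↥A ⊕ Fin n))) : Prop :=
  FinSat A p ∧ ∀ φ : L.Formula (↥A ⊕ Fin n), φ ∈ p ∨ BoundedFormula.not φ ∈ p

/-- `M` is ℵ₀-saturated: every finitely satisfiable set of formulas in one free
variable with parameters from a finite subset of `M` is realized in `M`. -/
def IsAleph0Saturated (L : FirstOrder.Language.{u, v}) (M : Type w) [L.Structure M] : Prop :=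
  ∀ A : Set M, A.Finite → ∀ p : Set (L.Formula (↥A ⊕ Fin 1)),
    FinSat A p → (typeSet A p).Nonempty

/-- `M` is ℵ₁-saturated: every finitely satisfiable set of formulas in one free
variable with parameters from a countable subset of `M` is realized in `M`. -/
def IsAleph1Saturated (L : FirstOrder.Language.{u, v}) (M : Type w) [L.Structure M] : Prop :=
  ∀ A : Set M, A.Countable → ∀ p : Set (L.Formula (↥A ⊕ Fin 1)),
    FinSat A p → (typeSet A p).Nonempty

/-- The definable closure of `A` in `M`. -/
def dclSet (L : FirstOrder.Language.{u, v}) {M : Type w} [L.Structure M] (A : Set M) : Set M :=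
  {a | ∃ φ : L.Formula (↥A ⊕ Fin 1),
    φ.Realize (pval ![a]) ∧ ∀ b : M, φ.Realize (pval ![b]) → b = a}

/-- `r` is a (strict) linear order on the set `D`. -/
def IsLinearOn {X : Type*} (r : X → X → Prop) (D : Set X) : Prop :=
  (∀ a ∈ D, ¬r a a) ∧
  (∀ a ∈ D, ∀ b ∈ D, ∀ c ∈ D, r a b → r b c → r a c) ∧
  (∀ a ∈ D, ∀ b ∈ D, a = b ∨ r a b ∨ r b a)

/-- The linear order `r` on `D` is discrete: every element other than the maximum
has an immediate successor and every element other than the minimum has an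
immediate predecessor. -/
def IsDiscreteOn {X : Type*} (r : X → X → Prop) (D : Set X) : Prop :=
  (∀ a ∈ D, (∃ b ∈ D, r a b) → ∃ b ∈ D, r a b ∧ ∀ c ∈ D, r a c → c = b ∨ r b c) ∧
  (∀ a ∈ D, (∃ b ∈ D, r b a) → ∃ b ∈ D, r b a ∧ ∀ c ∈ D, r c a → c = b ∨ r c b)

/-- `C` is an initial part of the order `(D, r)`. -/
def IsInitialPart {X : Type*} (r : X → X → Prop) (D C : Set X) : Prop :=
  C ⊆ D ∧ ∀ c ∈ C, ∀ d ∈ D, r d c → d ∈ C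

/-- `(C, r)` has order type ω: `C` is infinite and every element has only
finitely many predecessors in `C`. -/
def HasOrderTypeOmega {X : Type*} (r : X → X → Prop) (C : Set X) : Prop :=
  C.Infinite ∧ ∀ c ∈ C, {c' ∈ C | r c' c}.Finite

/-- `p` is a simple type over `A`, witnessed by `C ⊆ dcl(A)` and the `A`-definable
linear order `(D, <)` given by the formulas `δ` (defining `D`) and `lt` (defining `<`). -/
def IsSimpleWitness (A : Set M) (p : Set (L.Formula (↥A ⊕ Fin 1))) (C : Set M)
    (δ : L.Formula (↥A ⊕ Fin 1)) (lt : L.Formula (↥A ⊕ Fin 2)) : Prop :=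
  IsCompleteType A p ∧
  C.Infinite ∧
  C ⊆ dclSet L A ∧
  IsLinearOn (gRel A δ lt) (defSet A δ) ∧
  IsInitialPart (gRel A δ lt) (defSet A δ) C ∧
  HasOrderTypeOmega (gRel A δ lt) C ∧
  ∀ φ : L.Formula (↥A ⊕ Fin 1),
    φ ∈ p ↔ {c ∈ C | ¬φ.Realize (pval ![c])}.Finite

/-- `b` is the immediate successor of `a` in the order `(P, r)`. -/
def SuccIn {X : Type*} (r : X → X → Prop) (P : Set X) (a b : X) : Prop :=
  a ∈ P ∧ b ∈ P ∧ r a b ∧ ∀ c ∈ P, r a c → c = b ∨ r b c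

/-- `zIter S k a b` says that `b = Sᵏ(a)`, where negative iterates of `S` are
interpreted via the (partial) inverse of `S`. -/
def zIter {X : Type*} (S : X → X) (k : ℤ) (a b : X) : Prop :=
  if 0 ≤ k then S^[k.toNat] a = b else S^[(-k).toNat] b = a

/-- Isomorphism as an equivalence relation on countably infinite models of `T`
(with underlying set in `Type 0`). -/
def countableModelSetoid (T : L.Theory) :
    Setoid {N : Theory.ModelType.{u, v, 0} T // Countable N ∧ Infinite N} where
  r N₁ N₂ := Nonempty (N₁.1 ≃[L] N₂.1)
  iseqv := ⟨fun N => ⟨FirstOrder.Language.Equiv.refl L N.1⟩,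
    fun e => e.map FirstOrder.Language.Equiv.symm,
    fun e f => Nonempty.map2 (fun i j => j.comp i) e f⟩

/-- The number of countably infinite models of `T` up to isomorphism. -/
noncomputable def numCountableModels (T : L.Theory) : Cardinal :=
  #(Quotient (countableModelSetoid T))

section General

variable {L : FirstOrder.Language.{u, v}} {M : Type w} [L.Structure M]

theorem formula_congr {α : Type*} [DecidableEq α] (φ : L.Formula α) {x y : α → M}
    (h : ∀ a ∈ φ.freeVarFinset, x a = y a) : φ.Realize x ↔ φ.Realize y := by
  have h1 := BoundedFormula.realize_restrictFreeVar (φ := φ) (f := id)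
    (v := fun a => y a) (xs := (default : Fin 0 → M)) x (by intro a; exact (h a a.2).symm)
  have h2 := BoundedFormula.realize_restrictFreeVar (φ := φ) (f := id)
    (v := fun a => y a) (xs := (default : Fin 0 → M)) y (by intro a; rfl)
  exact h1.symm.trans h2

open Classical in
instance finite_inr_vars {α β : Type*} (φ : L.Formula (α ⊕ β)) :
    Finite {b : β // Sum.inr b ∈ φ.freeVarFinset} :=
  Finite.of_injective (fun b => (⟨Sum.inr b.1, b.2⟩ : φ.freeVarFinset)) (by
      intro b c h
      simpa [Subtype.ext_iff] using h)

open Classical in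
/-- Quantify existentially over all variables from an arbitrary type `β`. -/
noncomputable def exAll {α β : Type*} (φ : L.Formula (α ⊕ β)) : L.Formula α :=
  Formula.iExs {b : β // Sum.inr b ∈ φ.freeVarFinset}
    (φ.restrictFreeVar (fun z => match z with
      | ⟨Sum.inl a, _⟩ => Sum.inl a
      | ⟨Sum.inr b, h⟩ => Sum.inr ⟨b, h⟩))

theorem realize_exAll {α β : Type*} [Nonempty M] (φ : L.Formula (α ⊕ β)) (x : α → M) :
    (exAll φ).Realize x ↔ ∃ y : β → M, φ.Realize (Sum.elim x y) := by
  classical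
  unfold exAll
  rw [Formula.realize_iExs]
  constructor
  · rintro ⟨y, hy⟩
    refine ⟨fun b => if h : Sum.inr b ∈ φ.freeVarFinset then y ⟨b, h⟩
      else Classical.choice inferInstance, ?_⟩
    refine (BoundedFormula.realize_restrictFreeVar (φ := φ) _ ?_).1 hy
    rintro ⟨a | b, h⟩
    · simp
    · simp only [Sum.elim_inr]
      rw [dif_pos h]
  · rintro ⟨y, hy⟩
    refine ⟨fun b => y b, ?_⟩
    refine (BoundedFormula.realize_restrictFreeVar (φ := φ) _ ?_).2 hy
    rintro ⟨a | b, h⟩ <;> simp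

theorem countable_formula (hL : L.card ≤ ℵ₀) (α : Type) [Countable α] :
    Countable (L.Formula α) := by
  have h : #(Σ n, L.BoundedFormula α n) ≤ ℵ₀ := by
    refine BoundedFormula.card_le.trans (max_le le_rfl ?_)
    refine Cardinal.add_le_aleph0.2 ⟨?_, ?_⟩
    · simp
    · simpa using hL
  have : Countable (Σ n, L.BoundedFormula α n) := mk_le_aleph0_iff.1 h
  exact Function.Injective.countable (f := fun φ : L.Formula α =>
    (⟨0, φ⟩ : Σ n, L.BoundedFormula α n)) (by intro a b h; simpa using h)

/-- Forcing conditions for the omitting types construction. -/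
def Cond (L : FirstOrder.Language.{u, v}) {M : Type w} [L.Structure M] {I : Type}
    (a : I → M) : Type _ :=
  {ψ : L.Formula (I ⊕ ℕ) // ∃ x : ℕ → M, ψ.Realize (Sum.elim a x)}

instance {I : Type} (a : I → M) : Preorder (Cond L a) where
  le φ ψ := ∀ x : ℕ → M, ψ.1.Realize (Sum.elim a x) → φ.1.Realize (Sum.elim a x)
  le_refl _ _ h := h
  le_trans _ _ _ h1 h2 x h := h1 x (h2 x h)

theorem omit_prep (hL : L.card ≤ ℵ₀) [Nonempty M] {I : Type} [Countable I]
    (a : I → M) (Γ : Set (L.Formula (I ⊕ Unit)))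
    (h : ∀ (ψ : L.Formula (I ⊕ ℕ)) (n : ℕ) (x : ℕ → M), ψ.Realize (Sum.elim a x) →
      ∃ γ ∈ Γ, ∃ x : ℕ → M, ψ.Realize (Sum.elim a x) ∧
        ¬ γ.Realize (Sum.elim a fun _ => x n)) :
    ∃ x : ℕ → ℕ → M,
      (∀ φ : L.Formula ((I ⊕ ℕ) ⊕ Unit),
        (∃ n, ∀ᶠ k in Filter.atTop,
          φ.Realize (Sum.elim (Sum.elim a (x k)) fun _ => x k n)) ∨
        (∀ᶠ k in Filter.atTop, ¬ ∃ y : Unit → M, φ.Realize (Sum.elim (Sum.elim a (x k)) y))) ∧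
      (∀ n, ∃ γ ∈ Γ, ∀ᶠ k in Filter.atTop, ¬ γ.Realize (Sum.elim a fun _ => x k n)) := by
  classical
  have := countable_formula hL ((I ⊕ ℕ) ⊕ Unit)
  let : Encodable (L.Formula ((I ⊕ ℕ) ⊕ Unit) ⊕ ℕ) := Encodable.ofCountable _
  let 𝒟 : L.Formula ((I ⊕ ℕ) ⊕ Unit) ⊕ ℕ → Order.Cofinal (Cond L a) := fun t =>
    match t with
    | Sum.inl φ =>
      { carrier := {ψ | (∃ n, ∀ x : ℕ → M, ψ.1.Realize (Sum.elim a x) →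
            φ.Realize (Sum.elim (Sum.elim a x) fun _ => x n)) ∨
          (∀ x : ℕ → M, ψ.1.Realize (Sum.elim a x) →
            ¬ ∃ y : Unit → M, φ.Realize (Sum.elim (Sum.elim a x) y))}
        isCofinal := by
          rintro ⟨ψ, x₀, hx₀⟩
          by_cases hy : ∃ x : ℕ → M, ψ.Realize (Sum.elim a x) ∧
            ∃ y : Unit → M, φ.Realize (Sum.elim (Sum.elim a x) y)
          · obtain ⟨x, hx, y, hy⟩ := hy
            obtain ⟨n, hn⟩ := Infinite.exists_notMem_finset
              ((ψ.freeVarFinset.preimage Sum.inr Sum.inr_injective.injOn) ∪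
              (φ.freeVarFinset.preimage (fun n => Sum.inl (Sum.inr n))
                (fun _ _ _ _ h => by simpa using h)))
            simp only [Finset.mem_union, Finset.mem_preimage, not_or] at hn
            let x' := Function.update x n (y ())
            have e1 : ψ.Realize (Sum.elim a x') := by
              refine (formula_congr ψ ?_).1 hx
              rintro (i | m) hm
              · rfl
              · have : m ≠ n := by rintro rfl; exact hn.1 hm
                exact (Function.update_of_ne this _ _).symm
            have e2 : φ.Realize (Sum.elim (Sum.elim a x') fun _ => x' n) := by
              refine (formula_congr φ ?_).1 hy
              rintro ((i | m) | t) hm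
              · rfl
              · have : m ≠ n := by rintro rfl; exact hn.2 (Finset.mem_preimage.2 hm)
                exact (Function.update_of_ne this _ _).symm
              · exact (Function.update_self n (y ()) x).symm
            let χ : L.Formula (I ⊕ ℕ) :=
              ψ ⊓ φ.relabel (Sum.elim id fun _ => Sum.inr n)
            have hχ : ∀ z : ℕ → M, χ.Realize (Sum.elim a z) ↔ ψ.Realize (Sum.elim a z) ∧
                φ.Realize (Sum.elim (Sum.elim a z) fun _ => z n) := by
              intro z
              simp only [χ, Formula.realize_inf, Formula.realize_relabel]
              refine and_congr Iff.rfl (iff_of_eq (congrArg _ ?_))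
              funext t
              rcases t with t | t <;> rfl
            refine ⟨⟨χ, x', (hχ x').2 ⟨e1, e2⟩⟩, Or.inl ⟨n, fun z hz => ((hχ z).1 hz).2⟩,
              fun z hz => ((hχ z).1 hz).1⟩
          · refine ⟨⟨ψ, x₀, hx₀⟩, Or.inr ?_, le_rfl⟩
            intro x hx hy'
            exact hy ⟨x, hx, hy'⟩ }
    | Sum.inr n =>
      { carrier := {ψ | ∃ γ ∈ Γ, ∀ x : ℕ → M, ψ.1.Realize (Sum.elim a x) →
            ¬ γ.Realize (Sum.elim a fun _ => x n)}
        isCofinal := by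
          rintro ⟨ψ, x₀, hx₀⟩
          obtain ⟨γ, hγ, x, hx, hx'⟩ := h ψ n x₀ hx₀
          let χ : L.Formula (I ⊕ ℕ) :=
              ψ ⊓ (γ.relabel (Sum.elim Sum.inl fun _ => Sum.inr n)).not
          have hχ : ∀ z : ℕ → M, χ.Realize (Sum.elim a z) ↔ ψ.Realize (Sum.elim a z) ∧
                ¬ γ.Realize (Sum.elim a fun _ => z n) := by
              intro z
              simp only [χ, Formula.realize_inf, Formula.realize_not, Formula.realize_relabel]
              refine and_congr Iff.rfl (not_congr (iff_of_eq (congrArg _ ?_)))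
              funext t
              rcases t with t | t <;> rfl
          exact ⟨⟨χ, x, (hχ x).2 ⟨hx, hx'⟩⟩, ⟨γ, hγ, fun z hz => ((hχ z).1 hz).2⟩,
              fun z hz => ((hχ z).1 hz).1⟩ }
  let p0 : Cond L a := ⟨⊤, fun _ => Classical.choice inferInstance, by simp⟩
  let s := Order.sequenceOfCofinals p0 𝒟
  have hmono : Monotone s := Order.sequenceOfCofinals.monotone p0 𝒟
  have hmem : ∀ i, s (Encodable.encode i + 1) ∈ 𝒟 i := Order.sequenceOfCofinals.encode_mem p0 𝒟
  choose x hx using fun k => (s k).2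
  have hx' : ∀ j k, j ≤ k → (s j).1.Realize (Sum.elim a (x k)) :=
    fun j k hjk => hmono hjk (x k) (hx k)
  refine ⟨x, ?_, ?_⟩
  · intro φ
    rcases hmem (Sum.inl φ) with ⟨n, hn⟩ | hn
    · left
      refine ⟨n, ?_⟩
      filter_upwards [Filter.eventually_ge_atTop _] with k hk
      exact hn _ (hx' _ k hk)
    · right
      filter_upwards [Filter.eventually_ge_atTop _] with k hk
      exact hn _ (hx' _ k hk)
  · intro n
    obtain ⟨γ, hγ, hn⟩ := hmem (Sum.inr n)
    refine ⟨γ, hγ, ?_⟩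
    filter_upwards [Filter.eventually_ge_atTop _] with k hk
    exact hn _ (hx' _ k hk)

theorem omit_types (hL : L.card ≤ ℵ₀) [Nonempty M] {I : Type} [Countable I]
    (a : I → M) (Γ : Set (L.Formula (I ⊕ Unit)))
    (h : ∀ (ψ : L.Formula (I ⊕ ℕ)) (n : ℕ) (x : ℕ → M), ψ.Realize (Sum.elim a x) →
      ∃ γ ∈ Γ, ∃ x : ℕ → M, ψ.Realize (Sum.elim a x) ∧
        ¬ γ.Realize (Sum.elim a fun _ => x n)) :
    ∃ (N : Type) (_ : L.Structure N) (b : I → N), Countable N ∧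
      (∀ φ : L.Formula I, φ.Realize a → φ.Realize b) ∧
      ∀ y : N, ∃ γ ∈ Γ, ¬ γ.Realize (Sum.elim b fun _ => y) := by
  classical
  obtain ⟨x, hx1, hx2⟩ := omit_prep hL a Γ h
  let U : Ultrafilter ℕ := Filter.hyperfilter ℕ
  have hU : (U : Filter ℕ) ≤ Filter.atTop := Nat.hyperfilter_le_atTop
  let N' := (U : Filter ℕ).Product (fun _ : ℕ => M)
  let ee : I ⊕ ℕ → ℕ → M := fun t k => Sum.elim a (x k) t
  let e : I ⊕ ℕ → N' := fun t => ((ee t : ℕ → M) : N')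
  have los : ∀ φ : L.Formula (I ⊕ ℕ), φ.Realize e ↔
      ∀ᶠ k in (U : Filter ℕ), φ.Realize (Sum.elim a (x k)) := fun φ =>
    Ultraproduct.realize_formula_cast (u := U) (M := fun _ => M) φ ee
  have henkin : ∀ (φ : L.Formula ((I ⊕ ℕ) ⊕ Unit)) (y : N'),
      φ.Realize (Sum.elim e fun _ => y) →
      ∃ n, φ.Realize (Sum.elim e fun _ => e (Sum.inr n)) := by
    intro φ y hy
    rcases hx1 φ with ⟨n, hn⟩ | hn
    · refine ⟨n, ?_⟩
      have h1 := (los (φ.relabel (Sum.elim id fun _ => Sum.inr n))).2 (by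
        refine Filter.Eventually.mono (Filter.Eventually.filter_mono hU hn) ?_
        intro k hk
        rw [Formula.realize_relabel]
        refine (iff_of_eq (congrArg _ ?_)).1 hk
        funext t
        rcases t with t | t <;> rfl)
      rw [Formula.realize_relabel] at h1
      refine (iff_of_eq (congrArg _ ?_)).1 h1
      funext t
      rcases t with t | t <;> rfl
    · exfalso
      have h1 := (los (exAll φ)).1 ((realize_exAll φ e).2 ⟨_, hy⟩)
      obtain ⟨k, hk1, hk2⟩ := (h1.and (Filter.Eventually.filter_mono hU hn)).exists
      exact hk2 ((realize_exAll φ _).1 hk1)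
  have hsurj : ∀ t, ∃ n, e (Sum.inr n) = e t := by
    intro t
    obtain ⟨n, hn⟩ := henkin
      (Term.equal (Term.var (Sum.inr ())) (Term.var (Sum.inl t))) (e t) (by simp)
    exact ⟨n, by simpa using hn⟩
  let f : ℕ → N' := fun n => e (Sum.inr n)
  have henkin' : ∀ {m : ℕ} (φ : L.Formula (Fin m ⊕ Unit)) (z : Fin m → ℕ) (y : N'),
      φ.Realize (Sum.elim (f ∘ z) fun _ => y) →
      ∃ n, φ.Realize (Sum.elim (f ∘ z) fun _ => f n) := by
    intro m φ z y hy
    have key : ∀ y : N', (φ.relabel (Sum.map (fun i => (Sum.inr (z i) : I ⊕ ℕ)) id)).Realize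
        (Sum.elim e fun _ : Unit => y) ↔ φ.Realize (Sum.elim (f ∘ z) fun _ => y) := by
      intro y
      rw [Formula.realize_relabel]
      refine iff_of_eq (congrArg _ ?_)
      funext t
      rcases t with t | t <;> rfl
    obtain ⟨n, hn⟩ := henkin _ y ((key y).2 hy)
    exact ⟨n, (key _).1 hn⟩
  let S : L.Substructure N' :=
    { carrier := Set.range f
      fun_mem := by
        intro m g z hz
        choose k hk using hz
        obtain ⟨n, hn⟩ := henkin' (m := m)
          (Term.equal (Term.var (Sum.inr ()))
            (Term.func g fun i => Term.var (Sum.inl i))) k (Structure.funMap g z) (by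
              have : (f ∘ k) = z := funext hk
              simp [this])
        refine ⟨n, ?_⟩
        have : (f ∘ k) = z := funext hk
        simpa [this] using hn }
  have hS : S.IsElementary := by
    refine S.isElementary_of_exists ?_
    intro m φ z y hy
    choose k hk using fun i => (z i).2
    have hfk : f ∘ k = (fun i => (z i : N')) := funext hk
    let σ : Empty ⊕ Fin (m + 1) → Fin m ⊕ Unit :=
      Sum.elim (fun t => t.elim) (Fin.snoc (α := fun _ => Fin m ⊕ Unit)
        (fun i => Sum.inl i) (Sum.inr ()))
    have key : ∀ y : N', (φ.toFormula.relabel σ).Realize (Sum.elim (f ∘ k) fun _ => y) ↔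
        φ.Realize default (Fin.snoc ((fun i => (z i : N'))) y : _ → N') := by
      intro y
      rw [Formula.realize_relabel, BoundedFormula.realize_toFormula, hfk]
      refine iff_of_eq (congrArg₂ _ (Subsingleton.elim _ _) ?_)
      funext t
      refine Fin.lastCases ?_ (fun i => ?_) t <;> simp [σ]
    obtain ⟨n, hn⟩ := henkin' (φ.toFormula.relabel σ) k y ((key y).2 hy)
    exact ⟨⟨f n, n, rfl⟩, (key _).1 hn⟩
  let S' : L.ElementarySubstructure N' := ⟨S, hS⟩
  have hc : Countable S := (Set.countable_range f).to_subtype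
  have hsm : Small.{0} S := Countable.toSmall _
  let N := Shrink.{0} S
  let E : S ≃ N := equivShrink.{0} S
  letI : L.Structure N := E.inducedStructure
  let F : S ≃[L] N := E.inducedStructureEquiv
  have he : ∀ t, e t ∈ S := fun t => hsurj t
  have real : ∀ {β : Type} (φ : L.Formula β) (z : β → S),
      φ.Realize (fun i => F (z i)) ↔ φ.Realize (fun i => (z i : N')) := by
    intro β φ z
    have h1 : φ.Realize (F ∘ z) ↔ φ.Realize z := StrongHomClass.realize_formula F φ
    have h2 : φ.Realize (S'.subtype ∘ (z : β → S')) ↔ φ.Realize (z : β → S') :=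
      S'.subtype.map_formula φ z
    exact h1.trans h2.symm
  refine ⟨N, inferInstance, fun i => F ⟨e (Sum.inl i), he _⟩,
    Countable.of_equiv _ E, ?_, ?_⟩
  · intro φ hφ
    refine (real φ (fun i => ⟨e (Sum.inl i), he _⟩)).2 ?_
    have h1 := (los (φ.relabel Sum.inl)).2 (Filter.Eventually.of_forall fun k => by
      rw [Formula.realize_relabel]
      exact hφ)
    rw [Formula.realize_relabel] at h1
    exact h1
  · intro y
    obtain ⟨⟨_, n, rfl⟩, rfl⟩ := F.surjective y
    obtain ⟨γ, hγ, hn⟩ := hx2 n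
    refine ⟨γ, hγ, ?_⟩
    intro hcon
    have h1 := (real γ (Sum.elim (fun i => ⟨e (Sum.inl i), he _⟩) fun _ => ⟨f n, n, rfl⟩)).1 (by
      refine (iff_of_eq (congrArg _ ?_)).1 hcon
      funext t
      rcases t with t | t <;> rfl)
    have h2 := (los (γ.relabel (Sum.elim Sum.inl fun _ => Sum.inr n))).1 (by
      rw [Formula.realize_relabel]
      refine (iff_of_eq (congrArg _ ?_)).1 h1
      funext t
      rcases t with t | t <;> rfl)
    obtain ⟨k, hk1, hk2⟩ := (h2.and (Filter.Eventually.filter_mono hU hn)).exists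
    apply hk2
    rw [Formula.realize_relabel] at hk1
    refine (iff_of_eq (congrArg _ ?_)).1 hk1
    funext t
    rcases t with t | t <;> rfl

end General
section Order

/-- `GR r D k x y`: `x` lies at least `k` steps below `y` in the order `(D, r)`. -/
def GR {X : Type*} (r : X → X → Prop) (D : X → Prop) : ℕ → X → X → Prop
  | 0, x, y => D x ∧ D y ∧ (x = y ∨ r x y)
  | k + 1, x, y => ∃ z, r x z ∧ GR r D k z y

/-- A strict linear order `r` on `D`, with field contained in `D`. -/
structure Lin {X : Type*} (r : X → X → Prop) (D : X → Prop) : Prop where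
  irr : ∀ x, ¬ r x x
  trans : ∀ x y z, r x y → r y z → r x z
  dom : ∀ x y, r x y → D x ∧ D y
  tot : ∀ x y, D x → D y → x = y ∨ r x y ∨ r y x

variable {X : Type*} {r : X → X → Prop} {D : X → Prop}

theorem Lin.GR_dom (h : Lin r D) {k : ℕ} {x y : X} (hg : GR r D k x y) : D x ∧ D y := by
  induction k generalizing x with
  | zero => exact ⟨hg.1, hg.2.1⟩
  | succ k ih =>
    obtain ⟨z, hz, hg⟩ := hg
    exact ⟨(h.dom _ _ hz).1, (ih hg).2⟩

theorem Lin.GR_zero_left (h : Lin r D) {k : ℕ} {x y z : X} (hx : GR r D 0 x y)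
    (hg : GR r D k y z) : GR r D k x z := by
  rcases hx.2.2 with rfl | hxy
  · exact hg
  · cases k with
    | zero =>
      refine ⟨hx.1, hg.2.1, ?_⟩
      rcases hg.2.2 with rfl | hyz
      · exact Or.inr hxy
      · exact Or.inr (h.trans _ _ _ hxy hyz)
    | succ k =>
      obtain ⟨u, hu, hg⟩ := hg
      exact ⟨u, h.trans _ _ _ hxy hu, hg⟩

theorem Lin.GR_add (h : Lin r D) {k l : ℕ} {x y z : X} (hx : GR r D k x y)
    (hg : GR r D l y z) : GR r D (k + l) x z := by
  induction k generalizing x with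
  | zero => rw [Nat.zero_add]; exact h.GR_zero_left hx hg
  | succ k ih =>
    obtain ⟨u, hu, hx⟩ := hx
    rw [Nat.succ_add]
    exact ⟨u, hu, ih hx⟩

theorem Lin.GR_split (h : Lin r D) {k l : ℕ} {x z : X} (hx : GR r D (k + l) x z) :
    ∃ u, GR r D k x u ∧ GR r D l u z := by
  induction k generalizing x with
  | zero =>
    rw [Nat.zero_add] at hx
    exact ⟨x, ⟨(h.GR_dom hx).1, (h.GR_dom hx).1, Or.inl rfl⟩, hx⟩
  | succ k ih =>
    rw [Nat.succ_add] at hx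
    obtain ⟨u, hu, hx⟩ := hx
    obtain ⟨t, h1, h2⟩ := ih hx
    exact ⟨t, ⟨u, hu, h1⟩, h2⟩

theorem Lin.GR_pred (h : Lin r D) {k : ℕ} {x y : X} (hx : GR r D (k + 1) x y) :
    GR r D k x y := by
  obtain ⟨u, hu, hx⟩ := hx
  exact h.GR_zero_left ⟨(h.dom _ _ hu).1, (h.dom _ _ hu).2, Or.inr hu⟩ hx

theorem Lin.GR_mono (h : Lin r D) {k l : ℕ} (hkl : k ≤ l) {x y : X} (hx : GR r D l x y) :
    GR r D k x y := by
  induction hkl with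
  | refl => exact hx
  | step _ ih => exact ih (h.GR_pred hx)

theorem Lin.GR_zero_right (h : Lin r D) {k : ℕ} {x y z : X} (hx : GR r D k x y)
    (hg : GR r D 0 y z) : GR r D k x z := h.GR_add hx hg

theorem Lin.GR_lt (h : Lin r D) {k : ℕ} {x y : X} (hx : GR r D (k + 1) x y) : r x y := by
  obtain ⟨u, hu, hx⟩ := h.GR_mono (Nat.succ_le_succ (Nat.zero_le k)) hx
  rcases hx.2.2 with rfl | h'
  · exact hu
  · exact h.trans _ _ _ hu h'

theorem Lin.GR_total (h : Lin r D) {x y : X} (hx : D x) (hy : D y) :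
    GR r D 0 x y ∨ GR r D 0 y x := by
  rcases h.tot x y hx hy with h1 | h1 | h1
  · exact Or.inl ⟨hx, hy, Or.inl h1⟩
  · exact Or.inl ⟨hx, hy, Or.inr h1⟩
  · exact Or.inr ⟨hy, hx, Or.inr h1⟩

/-- `x` and `y` are at distance less than `k`. -/
def Close (r : X → X → Prop) (D : X → Prop) (k : ℕ) (x y : X) : Prop :=
  ¬ GR r D k x y ∧ ¬ GR r D k y x

/-- `x` is infinitely far below `y`. -/
def Below (r : X → X → Prop) (D : X → Prop) (x y : X) : Prop := ∀ k, GR r D k x y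

theorem Lin.below_left (h : Lin r D) {k : ℕ} {x x' y : X} (hxy : Below r D x y)
    (hx' : D x') (hc : Close r D k x x') : Below r D x' y := by
  intro l
  obtain ⟨u, h1, h2⟩ := h.GR_split (hxy (k + l))
  rcases h.GR_total hx' (h.GR_dom h1).2 with h3 | h3
  · exact h.GR_zero_left h3 h2
  · exact absurd (h.GR_zero_right h1 h3) hc.1

theorem Lin.below_right (h : Lin r D) {k : ℕ} {x y y' : X} (hxy : Below r D x y)
    (hy' : D y') (hc : Close r D k y y') : Below r D x y' := by
  intro l
  obtain ⟨u, h1, h2⟩ := h.GR_split (hxy (l + k))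
  rcases h.GR_total (h.GR_dom h1).2 hy' with h3 | h3
  · exact h.GR_zero_right h1 h3
  · exact absurd (h.GR_zero_left h3 h2) hc.2

theorem Lin.below_irr (h : Lin r D) {x : X} (hx : Below r D x x) : False :=
  h.irr x (h.GR_lt (hx 1))

theorem Lin.below_trans (h : Lin r D) {x y z : X} (hx : Below r D x y)
    (hy : Below r D y z) : Below r D x z := by
  intro k
  exact h.GR_zero_right (hx k) (hy 0)

end Order

section Formulas

variable {L : FirstOrder.Language.{u, v}}

/-- The binary relation defined by a formula. -/
def rel2 (ltF : L.Formula (Fin 2)) (N : Type w) [L.Structure N] (x y : N) : Prop :=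
  ltF.Realize ![x, y]

/-- The unary relation defined by a formula. -/
def rel1 (dF : L.Formula (Fin 1)) (N : Type w) [L.Structure N] (x : N) : Prop :=
  dF.Realize (fun _ => x)

theorem realize_rel2 {N : Type w} [L.Structure N] (φ : L.Formula (Fin 2)) {ι : Type*}
    (i j : ι) (x : ι → N) : (φ.relabel ![i, j]).Realize x ↔ rel2 φ N (x i) (x j) := by
  rw [Formula.realize_relabel]
  refine iff_of_eq (congrArg _ ?_)
  funext t
  fin_cases t <;> rfl

theorem realize_rel1 {N : Type w} [L.Structure N] (φ : L.Formula (Fin 1)) {ι : Type*}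
    (i : ι) (x : ι → N) : (φ.relabel (fun _ => i)).Realize x ↔ rel1 φ N (x i) := by
  rw [Formula.realize_relabel]
  rfl

/-- Formulas defining the relations `GR`. -/
noncomputable def gF (dF : L.Formula (Fin 1)) (ltF : L.Formula (Fin 2)) : ℕ → L.Formula (Fin 2)
  | 0 => dF.relabel (fun _ => 0) ⊓ (dF.relabel (fun _ => 1) ⊓
      (Term.equal (Term.var 0) (Term.var 1) ⊔ ltF.relabel ![0, 1]))
  | k + 1 => exAll (α := Fin 2) (β := Unit)
      (ltF.relabel ![Sum.inl 0, Sum.inr ()] ⊓ (gF dF ltF k).relabel ![Sum.inr (), Sum.inl 1])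

theorem realize_gF (dF : L.Formula (Fin 1)) (ltF : L.Formula (Fin 2)) (k : ℕ)
    {N : Type w} [L.Structure N] (x y : N) :
    rel2 (gF dF ltF k) N x y ↔ GR (rel2 ltF N) (rel1 dF N) k x y := by
  have : Nonempty N := ⟨x⟩
  induction k generalizing x with
  | zero =>
    unfold rel2 gF GR
    simp only [Formula.realize_inf, Formula.realize_sup, realize_rel1, realize_rel2,
      Formula.realize_equal, Term.realize_var]
    rfl
  | succ k ih =>
    unfold rel2 gF GR
    rw [realize_exAll]
    simp only [Formula.realize_inf, realize_rel2]
    constructor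
    · rintro ⟨z, h1, h2⟩
      exact ⟨z (), h1, (ih _).1 h2⟩
    · rintro ⟨z, h1, h2⟩
      exact ⟨fun _ => z, h1, (ih _).2 h2⟩

theorem realize_gF' (dF : L.Formula (Fin 1)) (ltF : L.Formula (Fin 2)) (k : ℕ)
    {N : Type w} [L.Structure N] {ι : Type*} (i j : ι) (x : ι → N) :
    ((gF dF ltF k).relabel ![i, j]).Realize x ↔
      GR (rel2 ltF N) (rel1 dF N) k (x i) (x j) := by
  rw [realize_rel2, realize_gF]

/-- Formula saying that there are at least `k` elements below. -/
noncomputable def hF (dF : L.Formula (Fin 1)) (ltF : L.Formula (Fin 2)) (k : ℕ) :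
    L.Formula (Fin 1) :=
  exAll (α := Fin 1) (β := Unit) ((gF dF ltF k).relabel ![Sum.inr (), Sum.inl 0])

theorem realize_hF (dF : L.Formula (Fin 1)) (ltF : L.Formula (Fin 2)) (k : ℕ)
    {N : Type w} [L.Structure N] (x : N) :
    rel1 (hF dF ltF k) N x ↔ ∃ z, GR (rel2 ltF N) (rel1 dF N) k z x := by
  have : Nonempty N := ⟨x⟩
  unfold rel1 hF
  rw [realize_exAll]
  simp only [realize_gF']
  constructor
  · rintro ⟨z, h1⟩
    exact ⟨z (), h1⟩
  · rintro ⟨z, h1⟩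
    exact ⟨fun _ => z, h1⟩

/-- The data extracted from a simple type over the empty set. -/
structure Core (L : FirstOrder.Language.{u, v}) (M : Type w) [L.Structure M] where
  dF : L.Formula (Fin 1)
  ltF : L.Formula (Fin 2)
  c : ℕ → M
  lin : Lin (rel2 ltF M) (rel1 dF M)
  hlt : ∀ m n, rel2 ltF M (c m) (c n) ↔ m < n
  hseg : ∀ y n, rel2 ltF M y (c n) → ∃ m, y = c m
  hdcl : ∀ n, ∃ φ : L.Formula (Fin 1), ∀ y, rel1 φ M y ↔ y = c n
  hmin : ∀ φ : L.Formula (Fin 1), (∀ᶠ n in Filter.atTop, rel1 φ M (c n)) ∨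
    (∀ᶠ n in Filter.atTop, ¬ rel1 φ M (c n))

end Formulas

section Comb

variable {L : FirstOrder.Language.{u, v}} {M : Type w} [L.Structure M] (K : Core L M)

namespace Core

/-- Step relation. -/
abbrev G (k : ℕ) (x y : M) : Prop := GR (rel2 K.ltF M) (rel1 K.dF M) k x y

theorem c_inj {m n : ℕ} (h : K.c m = K.c n) : m = n := by
  rcases lt_trichotomy m n with h1 | h1 | h1
  · have := (K.hlt m n).2 h1
    rw [h] at this
    exact absurd this (K.lin.irr _)
  · exact h1
  · have := (K.hlt n m).2 h1
    rw [h] at this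
    exact absurd this (K.lin.irr _)

theorem c_D (n : ℕ) : rel1 K.dF M (K.c n) :=
  (K.lin.dom _ _ ((K.hlt n (n + 1)).2 (Nat.lt_succ_self n))).1

theorem G_le_c {k : ℕ} {y : M} {n : ℕ} (h : K.G k y (K.c n)) : ∃ m, y = K.c m := by
  have h0 := K.lin.GR_mono (Nat.zero_le k) h
  rcases h0.2.2 with h1 | h1
  · exact ⟨n, h1⟩
  · exact K.hseg _ _ h1

theorem G_iff (k a : ℕ) (y : M) :
    K.G k (K.c a) y ↔ rel1 K.dF M y ∧ ∀ n, y = K.c n → a + k ≤ n := by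
  induction k generalizing a with
  | zero =>
    constructor
    · rintro ⟨_, h2, h3⟩
      refine ⟨h2, ?_⟩
      rintro n rfl
      rcases h3 with h3 | h3
      · exact (K.c_inj h3).le
      · exact ((K.hlt _ _).1 h3).le
    · rintro ⟨h1, h2⟩
      refine ⟨K.c_D a, h1, ?_⟩
      rcases K.lin.tot _ _ (K.c_D a) h1 with h3 | h3 | h3
      · exact Or.inl h3
      · exact Or.inr h3
      · obtain ⟨m, rfl⟩ := K.hseg _ _ h3
        have h4 := (K.hlt _ _).1 h3
        have h5 := h2 m rfl
        omega
  | succ k ih =>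
    constructor
    · rintro ⟨z, h1, h2⟩
      refine ⟨(K.lin.GR_dom h2).2, ?_⟩
      rintro n rfl
      obtain ⟨m, rfl⟩ := K.G_le_c h2
      have h3 := (K.hlt _ _).1 h1
      have h4 := ((ih m).1 h2).2 n rfl
      omega
    · rintro ⟨h1, h2⟩
      refine ⟨K.c (a + 1), (K.hlt _ _).2 (Nat.lt_succ_self a), (ih _).2 ⟨h1, ?_⟩⟩
      intro n hn
      have := h2 n hn
      omega

theorem G_c (k a b : ℕ) : K.G k (K.c a) (K.c b) ↔ a + k ≤ b := by
  rw [K.G_iff]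
  constructor
  · rintro ⟨_, h⟩
    exact h b rfl
  · intro h
    refine ⟨K.c_D b, ?_⟩
    intro n hn
    rw [← K.c_inj hn]
    exact h

theorem H_c (k b : ℕ) : (∃ z, K.G k z (K.c b)) ↔ k ≤ b := by
  constructor
  · rintro ⟨z, hz⟩
    obtain ⟨m, rfl⟩ := K.G_le_c hz
    have := (K.G_c _ _ _).1 hz
    omega
  · intro h
    exact ⟨K.c 0, (K.G_c _ _ _).2 (by omega)⟩

/-- Traces on `C` of definable relations. -/
def Def {ι : Type*} (R : (ι → ℕ) → Prop) : Prop :=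
  ∃ φ : L.Formula ι, ∀ x, R x ↔ φ.Realize (fun i => K.c (x i))

/-- Guarded relations. -/
def Guard {ι κ : Type*} (B : (ι → ℕ) → (κ → ℕ) → Prop) : Prop :=
  ∃ β : L.Formula (ι ⊕ κ), ∀ (x : ι → ℕ) (y : κ → M),
    β.Realize (Sum.elim (fun i => K.c (x i)) y) ↔ ∃ z : κ → ℕ, y = (fun j => K.c (z j)) ∧ B x z

variable {K}

theorem Def.not {ι : Type*} {R : (ι → ℕ) → Prop} (h : K.Def R) : K.Def (fun x => ¬ R x) := by
  obtain ⟨φ, hφ⟩ := h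
  exact ⟨φ.not, fun x => by rw [Formula.realize_not, ← hφ]⟩

theorem Def.and {ι : Type*} {R S : (ι → ℕ) → Prop} (h : K.Def R) (h' : K.Def S) :
    K.Def (fun x => R x ∧ S x) := by
  obtain ⟨φ, hφ⟩ := h
  obtain ⟨ψ, hψ⟩ := h'
  exact ⟨φ ⊓ ψ, fun x => by rw [Formula.realize_inf, ← hφ, ← hψ]⟩

theorem Def.iff {ι : Type*} {R S : (ι → ℕ) → Prop} (h : K.Def R) (h' : K.Def S) :
    K.Def (fun x => (R x ↔ S x)) := by
  obtain ⟨φ, hφ⟩ := h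
  obtain ⟨ψ, hψ⟩ := h'
  exact ⟨φ.iff ψ, fun x => by rw [Formula.realize_iff, ← hφ, ← hψ]⟩

theorem Def.relabel {ι κ : Type*} {R : (ι → ℕ) → Prop} (h : K.Def R) (g : ι → κ) :
    K.Def (fun x => R (fun i => x (g i))) := by
  obtain ⟨φ, hφ⟩ := h
  exact ⟨φ.relabel g, fun x => by rw [Formula.realize_relabel]; exact hφ _⟩

theorem Def.ex {ι κ : Type*} {R : (ι ⊕ κ → ℕ) → Prop} (h : K.Def R)
    {B : (ι → ℕ) → (κ → ℕ) → Prop} (hB : K.Guard B) :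
    K.Def (fun x => ∃ z, B x z ∧ R (Sum.elim x z)) := by
  obtain ⟨φ, hφ⟩ := h
  obtain ⟨β, hβ⟩ := hB
  have : Nonempty M := ⟨K.c 0⟩
  refine ⟨exAll (β ⊓ φ), fun x => ?_⟩
  rw [realize_exAll]
  have key : ∀ z : κ → ℕ, (fun i => K.c (Sum.elim x z i)) =
      Sum.elim (fun i => K.c (x i)) (fun j => K.c (z j)) := by
    intro z
    funext t
    rcases t with t | t <;> rfl
  constructor
  · rintro ⟨z, h1, h2⟩
    refine ⟨fun j => K.c (z j), ?_⟩
    rw [Formula.realize_inf]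
    refine ⟨(hβ _ _).2 ⟨z, rfl, h1⟩, ?_⟩
    rw [← key]
    exact (hφ _).1 h2
  · rintro ⟨y, hy⟩
    rw [Formula.realize_inf] at hy
    obtain ⟨h1, h2⟩ := hy
    obtain ⟨z, rfl, hz⟩ := (hβ _ _).1 h1
    refine ⟨z, hz, (hφ _).2 ?_⟩
    rw [key]
    exact h2

variable (K)

theorem def_le {ι : Type*} (i j : ι) : K.Def (fun x => x i ≤ x j) :=
  ⟨(gF K.dF K.ltF 0).relabel ![i, j], fun x => by
    rw [realize_gF']
    exact (K.G_c 0 _ _).symm⟩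

theorem guard_lt {ι κ : Type*} [Finite κ] (i : ι) (l : ℕ) :
    K.Guard (fun (x : ι → ℕ) (z : κ → ℕ) => ∀ j, z j < x i + l) := by
  refine ⟨Formula.iInf (fun j : κ => K.dF.relabel (fun _ => Sum.inr j) ⊓
    ((gF K.dF K.ltF l).relabel ![Sum.inl i, Sum.inr j]).not), fun x y => ?_⟩
  rw [Formula.realize_iInf]
  simp only [Formula.realize_inf, Formula.realize_not, realize_rel1, realize_gF',
    Sum.elim_inl, Sum.elim_inr]
  have key : ∀ j, (rel1 K.dF M (y j) ∧ ¬ K.G l (K.c (x i)) (y j)) ↔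
      ∃ n, y j = K.c n ∧ n < x i + l := by
    intro j
    rw [K.G_iff]
    constructor
    · rintro ⟨h1, h2⟩
      by_contra h3
      refine h2 ⟨h1, fun n hn => ?_⟩
      by_contra h4
      exact h3 ⟨n, hn, not_le.1 h4⟩
    · rintro ⟨n, hn, hlt⟩
      refine ⟨hn ▸ K.c_D n, ?_⟩
      rintro ⟨_, h2⟩
      have := h2 n hn
      omega
  constructor
  · intro h
    choose z hz hz' using fun j => (key j).1 (h j)
    exact ⟨z, funext hz, hz'⟩
  · rintro ⟨z, rfl, hz⟩ j
    exact (key j).2 ⟨z j, rfl, hz j⟩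

theorem guard_add {ι : Type*} (i : ι) (l : ℕ) :
    K.Guard (fun (x : ι → ℕ) (z : Unit → ℕ) => z () = x i + l) := by
  refine ⟨(gF K.dF K.ltF l).relabel ![Sum.inl i, Sum.inr ()] ⊓
    ((gF K.dF K.ltF (l + 1)).relabel ![Sum.inl i, Sum.inr ()]).not, fun x y => ?_⟩
  simp only [Formula.realize_inf, Formula.realize_not, realize_gF',
    Sum.elim_inl, Sum.elim_inr]
  have h1 := K.G_iff l (x i) (y ())
  have h2 := K.G_iff (l + 1) (x i) (y ())
  refine (and_congr h1 (not_congr h2)).trans ?_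
  constructor
  · rintro ⟨⟨h1, h2⟩, h3⟩
    have : ∃ n, y () = K.c n ∧ n < x i + (l + 1) := by
      by_contra h4
      refine h3 ⟨h1, fun n hn => ?_⟩
      by_contra h5
      exact h4 ⟨n, hn, not_le.1 h5⟩
    obtain ⟨n, hn, hlt⟩ := this
    refine ⟨fun _ => n, funext fun _ => hn, ?_⟩
    have := h2 n hn
    show n = x i + l
    omega
  · rintro ⟨z, rfl, hz⟩
    refine ⟨⟨K.c_D _, fun n hn => ?_⟩, ?_⟩
    · rw [← K.c_inj hn]; omega
    · rintro ⟨_, h⟩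
      have := h _ rfl
      omega

theorem guard_const {ι κ : Type*} [Finite κ] (z₀ : κ → ℕ) :
    K.Guard (fun (_ : ι → ℕ) (z : κ → ℕ) => z = z₀) := by
  choose φ hφ using K.hdcl
  refine ⟨Formula.iInf (fun j : κ => (φ (z₀ j)).relabel (fun _ => Sum.inr j)), fun x y => ?_⟩
  rw [Formula.realize_iInf]
  simp only [realize_rel1, hφ, Sum.elim_inr]
  constructor
  · intro h
    exact ⟨z₀, funext h, rfl⟩
  · rintro ⟨z, rfl, rfl⟩ j
    rfl

variable {K}

theorem Def.congr {ι : Type*} {R S : (ι → ℕ) → Prop} (h : K.Def R) (h' : ∀ x, R x ↔ S x) :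
    K.Def S := by
  have : R = S := funext fun x => propext (h' x)
  exact this ▸ h

theorem Def.add {ι : Type*} {R : (ι ⊕ Unit → ℕ) → Prop} (h : K.Def R) (i : ι) (l : ℕ) :
    K.Def (fun x => R (Sum.elim x fun _ => x i + l)) := by
  refine (h.ex (K.guard_add i l)).congr fun x => ?_
  constructor
  · rintro ⟨z, hz, h⟩
    have : z = fun _ => x i + l := funext fun _ => hz
    rw [← this]
    exact h
  · intro h
    exact ⟨_, rfl, h⟩

theorem Def.all {ι κ : Type*} {R : (ι ⊕ κ → ℕ) → Prop} (h : K.Def R)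
    {B : (ι → ℕ) → (κ → ℕ) → Prop} (hB : K.Guard B) :
    K.Def (fun x => ∀ z, B x z → R (Sum.elim x z)) := by
  refine (h.not.ex hB).not.congr fun x => ?_
  push Not
  rfl

theorem Def.dich {R : (Fin 1 → ℕ) → Prop} (h : K.Def R) :
    (∀ᶠ n in Filter.atTop, R (fun _ => n)) ∨ (∀ᶠ n in Filter.atTop, ¬ R (fun _ => n)) := by
  obtain ⟨φ, hφ⟩ := h
  rcases K.hmin φ with h | h
  · exact Or.inl (h.mono fun n hn => (hφ _).2 hn)
  · exact Or.inr (h.mono fun n hn => fun hn' => hn ((hφ _).1 hn'))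

theorem Def.stab {n : ℕ} {R : (Fin (n + 1) ⊕ Unit → ℕ) → Prop} (h : K.Def R) :
    ∃ N, ∀ (x : Fin (n + 1) → ℕ) (d : ℕ), (∀ j, x j + N < d) →
      (R (Sum.elim x fun _ => d) ↔ R (Sum.elim x fun _ => d + 1)) := by
  have hF : K.Def (fun t : Fin (n + 1) ⊕ Unit → ℕ =>
      (R t ↔ R (Sum.elim (fun j => t (Sum.inl j)) fun _ => t (Sum.inr ()) + 1))) := by
    refine h.iff ?_
    have h1 := (h.relabel (κ := (Fin (n + 1) ⊕ Unit) ⊕ Unit)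
      (Sum.elim (fun j => Sum.inl (Sum.inl j)) (fun _ => Sum.inr ()))).add (Sum.inr ()) 1
    refine h1.congr fun t => iff_of_eq (congrArg _ ?_)
    funext s
    rcases s with s | s <;> rfl
  let E : ℕ → ℕ → Prop := fun m d => m ≤ d ∧ ∀ x : Fin (n + 1) → ℕ, (∀ j, x j < m) →
      (R (Sum.elim x fun _ => d) ↔ R (Sum.elim x fun _ => d + 1))
  have hE : K.Def (fun s : Fin 2 → ℕ => E (s 0) (s 1)) := by
    refine (K.def_le (0 : Fin 2) 1).and ?_
    have h1 := (hF.relabel (κ := Fin 2 ⊕ Fin (n + 1))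
      (Sum.elim (fun j => Sum.inr j) (fun _ => Sum.inl 1))).all (K.guard_lt (0 : Fin 2) 0)
    refine h1.congr fun s => forall_congr' fun x => imp_congr Iff.rfl
      (iff_congr (iff_of_eq (congrArg _ ?_)) (iff_of_eq (congrArg _ ?_)))
    · funext t
      rcases t with t | t <;> rfl
    · funext t
      rcases t with t | t <;> rfl
  have hQ : K.Def (fun s : Fin 1 → ℕ => ∃ z : Unit → ℕ, (∀ j, z j < s 0 + 2) ∧
      (E (z ()) (s 0 + 1) ∧ ¬ E (z ()) (s 0))) := by
    have h0 : K.Def (fun s : Fin 1 ⊕ Unit → ℕ => E (s (Sum.inr ())) (s (Sum.inl 0) + 1)) :=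
      (hE.relabel (κ := (Fin 1 ⊕ Unit) ⊕ Unit)
        (![Sum.inl (Sum.inr ()), Sum.inr ()])).add (Sum.inl 0) 1
    have h1 : K.Def (fun s : Fin 1 ⊕ Unit → ℕ => E (s (Sum.inr ())) (s (Sum.inl 0))) :=
      hE.relabel ![Sum.inr (), Sum.inl 0]
    exact (h0.and h1.not).ex (K.guard_lt (κ := Unit) (0 : Fin 1) 2)
  have Emono : ∀ {m m' d}, m' ≤ m → E m d → E m' d := by
    rintro m m' d hm ⟨h1, h2⟩
    exact ⟨hm.trans h1, fun x hx => h2 x fun j => (hx j).trans_le hm⟩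
  have Eev : ∀ m, ∀ᶠ d in Filter.atTop, E m d := by
    intro m
    have hx : ∀ x : Fin (n + 1) → ℕ, ∀ᶠ d in Filter.atTop,
        (R (Sum.elim x fun _ => d) ↔ R (Sum.elim x fun _ => d + 1)) := by
      intro x
      have h1 : K.Def (fun s : Fin 1 → ℕ => R (Sum.elim x s ∘ Sum.map id (fun _ => 0))) := by
        have h2 := (h.relabel (κ := Fin 1 ⊕ Fin (n + 1))
          (Sum.elim (fun j => Sum.inr j) (fun _ => Sum.inl 0))).ex (K.guard_const (ι := Fin 1) x)
        refine h2.congr fun s => ?_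
        constructor
        · rintro ⟨z, rfl, h⟩
          refine (iff_of_eq (congrArg _ ?_)).1 h
          funext t
          rcases t with t | t <;> rfl
        · intro h
          refine ⟨x, rfl, ?_⟩
          refine (iff_of_eq (congrArg _ ?_)).1 h
          funext t
          rcases t with t | t <;> rfl
      have h3 : ∀ d, (Sum.elim x (fun _ : Fin 1 => d) ∘ Sum.map id (fun _ : Unit => 0)) =
          Sum.elim x (fun _ => d) := by
        intro d
        funext t
        rcases t with t | t <;> rfl
      have h4 := h1.dich
      simp only [h3] at h4
      rcases h4 with h4 | h4
      · have h5 := (Filter.tendsto_add_atTop_nat 1).eventually h4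
        filter_upwards [h4, h5] with d h6 h7
        exact iff_of_true h6 h7
      · have h5 := (Filter.tendsto_add_atTop_nat 1).eventually h4
        filter_upwards [h4, h5] with d h6 h7
        exact iff_of_false h6 h7
    have hfin : {x : Fin (n + 1) → ℕ | ∀ j, x j < m}.Finite := by
      have := Set.Finite.pi' (fun _ : Fin (n + 1) => Set.finite_Iio m)
      exact this
    have h6 := (Filter.eventually_all_finite hfin).2 fun x _ => hx x
    filter_upwards [h6, Filter.eventually_ge_atTop m] with d h7 h8
    exact ⟨h8, fun x hx => h7 x hx⟩
  rcases hQ.dich with h1 | h1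
  · obtain ⟨N, hN⟩ := Filter.eventually_atTop.1 h1
    have key : ∀ t, E t (N + t) := by
      intro t
      induction t with
      | zero => exact ⟨Nat.zero_le _, fun x hx => absurd (hx 0) (Nat.not_lt_zero _)⟩
      | succ t ih =>
        obtain ⟨z, _, hz1, hz2⟩ := hN (N + t) (Nat.le_add_right _ _)
        refine Emono ?_ hz1
        by_contra h2
        exact hz2 (Emono (by omega) ih)
    refine ⟨N, fun x d hd => ?_⟩
    have h2 := hd 0
    obtain ⟨t, rfl⟩ : ∃ t, d = N + t := ⟨d - N, by omega⟩
    refine (key t).2 x fun j => ?_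
    have := hd j
    omega
  · exfalso
    obtain ⟨N, hN⟩ := Filter.eventually_atTop.1 h1
    have step : ∀ m t, E m (N + t) → E m N := by
      intro m t
      induction t with
      | zero => exact id
      | succ t ih =>
        intro h2
        apply ih
        by_contra h3
        refine hN (N + t) (Nat.le_add_right _ _) ⟨fun _ => m, fun _ => ?_, h2, h3⟩
        show m < N + t + 2
        have := h2.1
        omega
    obtain ⟨d, hd1, hd2⟩ := ((Eev (N + 1)).and (Filter.eventually_ge_atTop N)).exists
    obtain ⟨t, rfl⟩ : ∃ t, d = N + t := ⟨d - N, by omega⟩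
    have := (step _ _ hd1).1
    omega

/-- Increasing `k`-sparse tuples. -/
def Sparse {n : ℕ} (k : ℕ) (x : Fin n → ℕ) : Prop :=
  (∀ i, k ≤ x i) ∧ ∀ i j, i < j → x i + k ≤ x j

theorem Def.const : ∀ {n : ℕ} {R : (Fin n → ℕ) → Prop}, K.Def R →
    ∃ k, ∀ x y, Sparse k x → Sparse k y → (R x ↔ R y) := by
  intro n
  induction n with
  | zero =>
    intro R _
    exact ⟨0, fun x y _ _ => by rw [Subsingleton.elim x y]⟩
  | succ n ih =>
    intro R h
    rcases n with _ | n
    · have key : ∀ x : Fin 1 → ℕ, x = fun _ => x 0 := fun x =>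
        funext fun i => by rw [Subsingleton.elim i 0]
      rcases h.dich with h1 | h1
      · obtain ⟨N, hN⟩ := Filter.eventually_atTop.1 h1
        refine ⟨N, fun x y hx hy => iff_of_true ?_ ?_⟩
        · rw [key x]; exact hN _ (hx.1 0)
        · rw [key y]; exact hN _ (hy.1 0)
      · obtain ⟨N, hN⟩ := Filter.eventually_atTop.1 h1
        refine ⟨N, fun x y hx hy => iff_of_false ?_ ?_⟩
        · rw [key x]; exact hN _ (hx.1 0)
        · rw [key y]; exact hN _ (hy.1 0)
    · let σ : Fin (n + 1 + 1) → Fin (n + 1) ⊕ Unit :=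
        Fin.snoc (α := fun _ => Fin (n + 1) ⊕ Unit) (fun i => Sum.inl i) (Sum.inr ())
      have h0 := h.relabel σ
      obtain ⟨N, hN⟩ := h0.stab
      have hN' : ∀ (x : Fin (n + 1) → ℕ) (d l : ℕ), (∀ j, x j + N < d) →
          (R (fun i => Sum.elim x (fun _ => d) (σ i)) ↔
            R (fun i => Sum.elim x (fun _ => d + l) (σ i))) := by
        intro x d l hd
        induction l with
        | zero => exact Iff.rfl
        | succ l ih =>
          refine ih.trans (hN x (d + l) fun j => ?_)
          have := hd j
          omega
      have h1 := h0.add (Fin.last n) (N + 1)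
      obtain ⟨k, hk⟩ := ih h1
      have conv : ∀ x : Fin (n + 1 + 1) → ℕ, Sparse (max k (N + 1)) x →
          (R x ↔ R (fun i => Sum.elim (fun j : Fin (n + 1) => x j.castSucc)
            (fun _ => x (Fin.last n).castSucc + (N + 1)) (σ i))) := by
        intro x hx
        have h2 := hx.2 (Fin.last n).castSucc (Fin.last (n + 1)) (Fin.castSucc_lt_last _)
        obtain ⟨l, hl⟩ : ∃ l, x (Fin.last (n + 1)) =
            x (Fin.last n).castSucc + (N + 1) + l :=
          ⟨x (Fin.last (n + 1)) - (x (Fin.last n).castSucc + (N + 1)), by omega⟩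
        rw [hN' (fun j : Fin (n + 1) => x j.castSucc) _ l, ← hl]
        · refine iff_of_eq (congrArg _ ?_)
          funext i
          refine Fin.lastCases ?_ (fun i => ?_) i <;> simp [σ]
        · intro j
          have h3 : x j.castSucc ≤ x (Fin.last n).castSucc := by
            rcases (Fin.le_last j).lt_or_eq with h4 | h4
            · have := hx.2 j.castSucc (Fin.last n).castSucc (by simpa using h4)
              omega
            · rw [h4]
          omega
      have sp : ∀ x : Fin (n + 1 + 1) → ℕ, Sparse (max k (N + 1)) x →
          Sparse k (fun j : Fin (n + 1) => x j.castSucc) := by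
        intro x hx
        refine ⟨fun i => (le_max_left _ _).trans (hx.1 _), fun i j hij => ?_⟩
        have := hx.2 i.castSucc j.castSucc (by simpa using hij)
        show x i.castSucc + k ≤ x j.castSucc
        omega
      refine ⟨max k (N + 1), fun x y hx hy => ?_⟩
      rw [conv x hx, conv y hy]
      exact hk _ _ (sp x hx) (sp y hy)

end Core

end Comb


section Pattern

variable {L : FirstOrder.Language.{u, v}} {M : Type w} [L.Structure M] (K : Core L M)

namespace Core

/-- Unordered `k`-sparse tuples. -/
def USparse {ι : Type*} (k : ℕ) (x : ι → ℕ) : Prop :=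
  (∀ i, k ≤ x i) ∧ ∀ i j, i ≠ j → x i + k ≤ x j ∨ x j + k ≤ x i

variable {K}

theorem Def.pattern {ι : Type*} [Finite ι] {R : (ι → ℕ) → Prop} (h : K.Def R) :
    ∃ k, 1 ≤ k ∧ ∀ x y, USparse k x → USparse k y → (∀ i j, x i < x j ↔ y i < y j) →
      (R x ↔ R y) := by
  obtain ⟨n, ⟨e0⟩⟩ := Finite.exists_equiv_fin ι
  choose k hk using fun e : Fin n ≃ ι => (h.relabel e.symm).const
  have hfin : Finite (Fin n ≃ ι) := by
    have := Fintype.ofFinite ι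
    classical
    infer_instance
  have := Fintype.ofFinite (Fin n ≃ ι)
  refine ⟨Finset.univ.sup k + 1, Nat.le_add_left _ _, fun x y hx hy hxy => ?_⟩
  have hinj : Function.Injective x := by
    intro i j hij
    by_contra hne
    have := hx.2 i j hne
    omega
  let e : Fin n ≃ ι := (Tuple.sort (x ∘ e0.symm)).trans e0.symm
  have hmono : Monotone (x ∘ e) := Tuple.monotone_sort (x ∘ e0.symm)
  have hsm : StrictMono (x ∘ e) := hmono.strictMono_of_injective (hinj.comp e.injective)
  have hke : k e ≤ Finset.univ.sup k := Finset.le_sup (Finset.mem_univ e)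
  have sx : Sparse (k e) (x ∘ e) := by
    refine ⟨fun i => ?_, fun i j hij => ?_⟩
    · have := hx.1 (e i)
      show k e ≤ x (e i)
      omega
    · have h1 := hx.2 (e i) (e j) (fun h => hij.ne (e.injective h))
      have h2 : x (e i) < x (e j) := hsm hij
      show x (e i) + k e ≤ x (e j)
      omega
  have sy : Sparse (k e) (y ∘ e) := by
    refine ⟨fun i => ?_, fun i j hij => ?_⟩
    · have := hy.1 (e i)
      show k e ≤ y (e i)
      omega
    · have h1 := hy.2 (e i) (e j) (fun h => hij.ne (e.injective h))
      have h2 : y (e i) < y (e j) := (hxy _ _).1 (hsm hij)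
      show y (e i) + k e ≤ y (e j)
      omega
  have := hk e _ _ sx sy
  simpa using this

variable (K)

/-- Realizations in `N` of the simple type. -/
def InP (N : Type*) [L.Structure N] (x : N) : Prop :=
  ∀ φ : L.Formula (Fin 1), (∀ᶠ n in Filter.atTop, rel1 φ M (K.c n)) → rel1 φ N x

/-- Being infinitely far below. -/
abbrev Bel (N : Type*) [L.Structure N] (x y : N) : Prop :=
  Below (rel2 K.ltF N) (rel1 K.dF N) x y

/-- Being close. -/
abbrev Clo (N : Type*) [L.Structure N] (k : ℕ) (x y : N) : Prop :=
  Close (rel2 K.ltF N) (rel1 K.dF N) k x y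

theorem ev_hF (k : ℕ) : ∀ᶠ n in Filter.atTop, rel1 (hF K.dF K.ltF k) M (K.c n) := by
  filter_upwards [Filter.eventually_ge_atTop k] with n hn
  rw [realize_hF]
  exact (K.H_c k n).2 hn

theorem InP.hF {N : Type*} [L.Structure N] {x : N} (h : K.InP N x) (k : ℕ) :
    ∃ z, GR (rel2 K.ltF N) (rel1 K.dF N) k z x := by
  rw [← realize_hF]
  exact h _ (K.ev_hF k)

theorem InP.D {N : Type*} [L.Structure N] {x : N} (h : K.InP N x) : rel1 K.dF N x :=
  h _ (Filter.Eventually.of_forall K.c_D)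

theorem homog {ι : Type*} [Finite ι] [Nonempty ι] (φ : L.Formula ι) :
    ∃ k, 1 ≤ k ∧ ∀ {N : Type w} [L.Structure N] (x : ι → N) (y : ι → ℕ), USparse k y →
      (∀ i, K.InP N (x i)) → (∀ i j, y i < y j → K.Bel N (x i) (x j)) →
      φ.Realize x → φ.Realize (fun i => K.c (y i)) := by
  have hR : K.Def (fun y => φ.Realize (fun i => K.c (y i))) := ⟨φ, fun _ => Iff.rfl⟩
  obtain ⟨k, hk1, hk⟩ := hR.pattern
  refine ⟨k, hk1, ?_⟩
  intro N _ x y hy hx hxy hφ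
  by_contra hc
  have hyinj : ∀ i j, i ≠ j → y i < y j ∨ y j < y i := by
    intro i j hij
    have := hy.2 i j hij
    omega
  let Λ : L.Formula (Fin 1) := exAll (α := Fin 1) (β := ι)
    (φ.relabel Sum.inr ⊓ (Formula.iInf (fun i : ι =>
        ((gF K.dF K.ltF 0).relabel ![Sum.inr i, Sum.inl 0] ⊓
          (PaperDef.hF K.dF K.ltF k).relabel (fun _ => Sum.inr i))) ⊓
      Formula.iInf (fun p : {p : ι × ι // y p.1 < y p.2} =>
        (gF K.dF K.ltF k).relabel ![Sum.inr p.1.1, Sum.inr p.1.2])))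
  have hΛ : ∀ {N' : Type w} [L.Structure N'] (z : N'), rel1 Λ N' z ↔ ∃ x' : ι → N',
      φ.Realize x' ∧ (∀ i, GR (rel2 K.ltF N') (rel1 K.dF N') 0 (x' i) z ∧
        ∃ u, GR (rel2 K.ltF N') (rel1 K.dF N') k u (x' i)) ∧
        ∀ i j, y i < y j → GR (rel2 K.ltF N') (rel1 K.dF N') k (x' i) (x' j) := by
    intro N' _ z
    have : Nonempty N' := ⟨z⟩
    refine (realize_exAll _ _).trans ?_
    simp only [Formula.realize_inf, Formula.realize_iInf, realize_gF', realize_rel1, realize_hF,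
      Subtype.forall, Prod.forall, Sum.elim_inr, Sum.elim_inl]
    simp only [Formula.realize_relabel, Sum.elim_comp_inr]
  obtain ⟨m, hm⟩ := Finite.exists_max y
  have h1 : rel1 Λ N (x m) := by
    rw [hΛ]
    refine ⟨x, hφ, fun i => ⟨?_, InP.hF K (hx i) k⟩, fun i j hij => hxy i j hij k⟩
    by_cases him : i = m
    · subst him
      exact ⟨InP.D K (hx _), InP.D K (hx _), Or.inl rfl⟩
    · have h1 := hyinj i m him
      have h2 := hm i
      exact hxy i m (by omega) 0
  have h2 : ∀ n, rel1 Λ.not M (K.c n) := by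
    intro n hn
    have hn' : rel1 Λ M (K.c n) := hn
    rw [hΛ] at hn'
    obtain ⟨x', h3, h4, h5⟩ := hn'
    choose z hz using fun i => K.G_le_c (h4 i).1
    have hxz : x' = fun i => K.c (z i) := funext hz
    subst hxz
    have h6 : ∀ i j, y i < y j → z i + k ≤ z j := fun i j hij =>
      (K.G_c k _ _).1 (h5 i j hij)
    refine hc ((hk z y ⟨fun i => (K.H_c k _).1 (h4 i).2, fun i j hij => ?_⟩ hy ?_).1 h3)
    · exact (hyinj i j hij).imp (h6 i j) (h6 j i)
    · intro i j
      constructor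
      · intro h7
        by_contra h8
        by_cases hij : i = j
        · subst hij; omega
        · have := h6 j i (by have := hyinj i j hij; omega)
          omega
      · intro h7
        have := h6 i j h7
        omega
  exact hx m Λ.not (Filter.Eventually.of_forall h2) h1

end Core

end Pattern

section Transfer

variable {L : FirstOrder.Language.{u, v}}

theorem transfer {M : Type*} {N : Type*} [L.Structure M] [L.Structure N] [Nonempty M]
    [Nonempty N] (h : ∀ φ : L.Formula Empty, ∀ x : Empty → M, φ.Realize x →
      ∀ y : Empty → N, φ.Realize y) {ι : Type*}
    (φ : L.Formula ι) (hφ : ∀ x : ι → M, φ.Realize x) (x : ι → N) : φ.Realize x := by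
  let χ : L.Formula Empty := (exAll (α := Empty) (β := ι) (φ.not.relabel Sum.inr)).not
  have h1 : χ.Realize (Empty.elim : Empty → M) := by
    rw [Formula.realize_not, realize_exAll]
    rintro ⟨y, hy⟩
    rw [Formula.realize_relabel, Formula.realize_not] at hy
    exact hy (hφ _)
  have h2 := h χ _ h1 (Empty.elim : Empty → N)
  rw [Formula.realize_not, realize_exAll] at h2
  by_contra h3
  refine h2 ⟨x, ?_⟩
  rw [Formula.realize_relabel, Formula.realize_not]
  exact h3

theorem transfer_lin {M : Type*} {N : Type*} [L.Structure M] [L.Structure N] [Nonempty M]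
    [Nonempty N] (h : ∀ φ : L.Formula Empty, ∀ x : Empty → M, φ.Realize x →
      ∀ y : Empty → N, φ.Realize y) {dF : L.Formula (Fin 1)} {ltF : L.Formula (Fin 2)}
    (hl : Lin (rel2 ltF M) (rel1 dF M)) : Lin (rel2 ltF N) (rel1 dF N) := by
  refine ⟨fun x => ?_, fun x y z => ?_, fun x y => ?_, fun x y => ?_⟩
  · have := transfer h (ltF.relabel ![(0 : Fin 1), 0]).not (fun x => by
      rw [Formula.realize_not, realize_rel2]
      exact hl.irr _) (fun _ => x)
    rw [Formula.realize_not, realize_rel2] at this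
    exact this
  · have := transfer h ((ltF.relabel ![(0 : Fin 3), 1]).imp ((ltF.relabel ![(1 : Fin 3), 2]).imp
      (ltF.relabel ![(0 : Fin 3), 2]))) (fun x => by
        simp only [Formula.realize_imp, realize_rel2]
        exact hl.trans _ _ _) ![x, y, z]
    simp only [Formula.realize_imp, realize_rel2] at this
    exact this
  · have := transfer h ((ltF.relabel ![(0 : Fin 2), 1]).imp
      (dF.relabel (fun _ => (0 : Fin 2)) ⊓ dF.relabel (fun _ => (1 : Fin 2)))) (fun x => by
        simp only [Formula.realize_imp, Formula.realize_inf, realize_rel2, realize_rel1]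
        exact hl.dom _ _) ![x, y]
    simp only [Formula.realize_imp, Formula.realize_inf, realize_rel2, realize_rel1] at this
    exact this
  · have := transfer h ((dF.relabel (fun _ => (0 : Fin 2))).imp
      ((dF.relabel (fun _ => (1 : Fin 2))).imp
        (Term.equal (Term.var 0) (Term.var 1) ⊔ (ltF.relabel ![(0 : Fin 2), 1] ⊔
          ltF.relabel ![(1 : Fin 2), 0])))) (fun x => by
        simp only [Formula.realize_imp, Formula.realize_sup, realize_rel2, realize_rel1,
          Formula.realize_equal, Term.realize_var]
        exact hl.tot _ _) ![x, y]
    simp only [Formula.realize_imp, Formula.realize_sup, realize_rel2, realize_rel1,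
          Formula.realize_equal, Term.realize_var] at this
    exact this

theorem Lin.far {X : Type*} {r : X → X → Prop} {D : X → Prop} (h : Lin r D) {x y : X}
    (hf : ∀ k, ¬ Close r D k x y) : Below r D x y ∨ Below r D y x := by
  by_contra hc
  rw [not_or] at hc
  unfold Below at hc
  push Not at hc
  obtain ⟨⟨k, hk⟩, ⟨l, hl⟩⟩ := hc
  exact hf (max k l) ⟨fun h1 => hk (h.GR_mono (le_max_left _ _) h1),
    fun h1 => hl (h.GR_mono (le_max_right _ _) h1)⟩

end Transfer

section Model

variable {L : FirstOrder.Language.{u, v}} {M : Type w} [L.Structure M] (K : Core L M)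

/-- Sparse assignments. -/
noncomputable def spv {I : Type} [LinearOrder I] (t : Finset I × ℕ) (i : I) : ℕ :=
  t.2 * ((t.1.filter (· < i)).card + 1)

theorem spv_ge {I : Type} [LinearOrder I] (t : Finset I × ℕ) (i : I) : t.2 ≤ spv t i :=
  Nat.le_mul_of_pos_right _ (Nat.succ_pos _)

theorem spv_lt {I : Type} [LinearOrder I] (t : Finset I × ℕ) {i j : I} (hi : i ∈ t.1)
    (hij : i < j) : spv t i + t.2 ≤ spv t j := by
  unfold spv
  have h : (t.1.filter (· < i)).card < (t.1.filter (· < j)).card := by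
    refine Finset.card_lt_card ?_
    rw [Finset.ssubset_iff_of_subset]
    · exact ⟨i, by simp [hi, hij], by simp⟩
    · intro x hx
      simp only [Finset.mem_filter] at hx ⊢
      exact ⟨hx.1, hx.2.trans hij⟩
  calc t.2 * ((t.1.filter (· < i)).card + 1) + t.2
      = t.2 * ((t.1.filter (· < i)).card + 1 + 1) := by ring
    _ ≤ _ := Nat.mul_le_mul_left _ (by omega)

namespace Core

theorem ultra {L : FirstOrder.Language.{u, v}} {M : Type w} [L.Structure M] (K : Core L M)
    (I : Type) [LinearOrder I] : ∃ (N : Type w) (_ : L.Structure N)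
    (cl : ((Finset I × ℕ) → M) → N), (∀ y, ∃ f, cl f = y) ∧
    ∃ U : Filter (Finset I × ℕ), U ≤ Filter.atTop ∧ U.NeBot ∧
    ∀ {ι : Type} (φ : L.Formula ι) (x : ι → (Finset I × ℕ) → M),
      φ.Realize (fun i => cl (x i)) ↔ ∀ᶠ t in U, φ.Realize (fun i => x i t) := by
  have : Nonempty M := ⟨K.c 0⟩
  let U : Ultrafilter (Finset I × ℕ) := Ultrafilter.of Filter.atTop
  refine ⟨(U : Filter (Finset I × ℕ)).Product (fun _ => M), inferInstance,
    fun f => (f : (U : Filter (Finset I × ℕ)).Product (fun _ => M)), ?_, U,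
    Ultrafilter.of_le _, inferInstance, ?_⟩
  · intro y
    exact Quotient.exists_rep y
  · intro ι φ x
    exact Ultraproduct.realize_formula_cast φ x

/-- The type to be omitted. -/
def gam (I : Type) : Set (L.Formula (I ⊕ Unit)) :=
  {γ | (∃ φ : L.Formula (Fin 1), (∀ᶠ n in Filter.atTop, rel1 φ M (K.c n)) ∧
      γ = φ.relabel (fun _ => Sum.inr ())) ∨
    ∃ i k, γ = (gF K.dF K.ltF k).relabel ![Sum.inr (), Sum.inl i] ⊔
      (gF K.dF K.ltF k).relabel ![Sum.inl i, Sum.inr ()]}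

theorem gam_iff {I : Type} {N : Type*} [L.Structure N] (b : I → N) (y : N) :
    (∃ γ ∈ K.gam I, ¬ γ.Realize (Sum.elim b fun _ => y)) ↔
      (¬ K.InP N y ∨ ∃ i k, K.Clo N k y (b i)) := by
  constructor
  · rintro ⟨γ, ⟨φ, hφ, rfl⟩ | ⟨i, k, rfl⟩, h⟩
    · rw [realize_rel1] at h
      exact Or.inl fun hy => h (hy φ hφ)
    · rw [Formula.realize_sup, realize_gF', realize_gF', not_or] at h
      exact Or.inr ⟨i, k, h⟩
  · rintro (h | ⟨i, k, h⟩)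
    · unfold InP at h
      push Not at h
      obtain ⟨φ, hφ, h⟩ := h
      refine ⟨_, Or.inl ⟨φ, hφ, rfl⟩, ?_⟩
      rw [realize_rel1]
      exact h
    · refine ⟨_, Or.inr ⟨i, k, rfl⟩, ?_⟩
      rw [Formula.realize_sup, realize_gF', realize_gF', not_or]
      exact h

theorem exists_model (hL : L.card ≤ ℵ₀) (I : Type) [LinearOrder I] [Countable I]
    [Nonempty I] :
    ∃ (N : Type) (_ : L.Structure N) (b : I → N), Countable N ∧ Nonempty N ∧
      (∀ φ : L.Formula Empty, ∀ x : Empty → M, φ.Realize x →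
        ∀ y : Empty → N, φ.Realize y) ∧
      (∀ i, K.InP N (b i)) ∧ (∀ i j, i < j → K.Bel N (b i) (b j)) ∧
      ∀ y, K.InP N y → ∃ i k, K.Clo N k y (b i) := by
  classical
  obtain ⟨M', _, cl, hcl, U, hU, hUne, los⟩ := K.ultra I
  have hMne : Nonempty M := ⟨K.c 0⟩
  have hM'ne : Nonempty M' := ⟨cl fun _ => K.c 0⟩
  let a : I → M' := fun i => cl (fun t => K.c (spv t i))
  have evs : ∀ (s : Finset I) (k : ℕ), ∀ᶠ t in U, s ⊆ t.1 ∧ k ≤ t.2 := by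
    intro s k
    exact hU (Filter.eventually_ge_atTop (s, k))
  have htr : ∀ φ : L.Formula Empty, ∀ x : Empty → M, φ.Realize x →
      ∀ y : Empty → M', φ.Realize y := by
    intro φ x hx y
    have := los φ (fun e : Empty => e.elim)
    rw [Subsingleton.elim y (fun i : Empty => cl (i.elim)), this]
    refine Filter.Eventually.of_forall fun t => ?_
    rw [Subsingleton.elim (fun i : Empty => _) x]
    exact hx
  have hlin := transfer_lin htr K.lin
  have los1 : ∀ (φ : L.Formula (Fin 1)) (x : (Finset I × ℕ) → M),
      rel1 φ M' (cl x) ↔ ∀ᶠ t in U, rel1 φ M (x t) := fun φ x => los φ (fun _ => x)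
  have los2 : ∀ (k : ℕ) (x y : (Finset I × ℕ) → M),
      GR (rel2 K.ltF M') (rel1 K.dF M') k (cl x) (cl y) ↔
        ∀ᶠ t in U, K.G k (x t) (y t) := by
    intro k x y
    have h1 := los ((gF K.dF K.ltF k).relabel ![(0 : Fin 2), 1]) ![x, y]
    simp only [realize_gF'] at h1
    exact h1
  have haP : ∀ i, K.InP M' (a i) := by
    intro i φ hφ
    rw [los1]
    obtain ⟨n, hn⟩ := Filter.eventually_atTop.1 hφ
    filter_upwards [evs ∅ n] with t ht
    exact hn _ (ht.2.trans (spv_ge _ _))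
  have haB : ∀ i j, i < j → K.Bel M' (a i) (a j) := by
    intro i j hij k
    rw [los2]
    filter_upwards [evs {i} k] with t ht
    rw [K.G_c]
    have := spv_lt t (ht.1 (Finset.mem_singleton_self i)) hij
    omega
  have hΓ := fun y => K.gam_iff a y
  have main : ∀ ψ : L.Formula (I ⊕ ℕ), ∀ n x, ψ.Realize (Sum.elim a x) →
      ∃ γ ∈ K.gam I, ∃ x, ψ.Realize (Sum.elim a x) ∧ ¬ γ.Realize (Sum.elim a fun _ => x n) := by
    intro ψ n x0 hx0
    suffices h : ∃ x, ψ.Realize (Sum.elim a x) ∧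
        (¬ K.InP M' (x n) ∨ ∃ i k, K.Clo M' k (x n) (a i)) by
      obtain ⟨x, h1, h2⟩ := h
      obtain ⟨γ, h3, h4⟩ := (hΓ (x n)).2 h2
      exact ⟨γ, h3, x, h1, h4⟩
    by_cases hx0' : (¬ K.InP M' (x0 n) ∨ ∃ i k, K.Clo M' k (x0 n) (a i))
    · exact ⟨x0, hx0, hx0'⟩
    rw [not_or, not_not, not_exists] at hx0'
    obtain ⟨hyP, hyF⟩ := hx0'
    have hyF' : ∀ i, K.Bel M' (x0 n) (a i) ∨ K.Bel M' (a i) (x0 n) := fun i =>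
      hlin.far (not_exists.1 (hyF i))
    let θ : L.Formula (I ⊕ Unit) := exAll (α := I ⊕ Unit) (β := ℕ)
      (ψ.relabel (Sum.elim (fun i => Sum.inl (Sum.inl i)) Sum.inr) ⊓
        Term.equal (Term.var (Sum.inr n)) (Term.var (Sum.inl (Sum.inr ()))))
    have hθ : ∀ y : M', θ.Realize (Sum.elim a fun _ => y) ↔
        ∃ x, ψ.Realize (Sum.elim a x) ∧ x n = y := by
      intro y
      refine (realize_exAll _ _).trans (exists_congr fun x => ?_)
      rw [Formula.realize_inf, Formula.realize_relabel, Formula.realize_equal]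
      refine and_congr (iff_of_eq (congrArg _ ?_)) Iff.rfl
      funext t
      rcases t with t | t <;> rfl
    let F : Finset (I ⊕ Unit) := insert (Sum.inr ()) θ.freeVarFinset
    have hFne : Nonempty F := ⟨⟨Sum.inr (), Finset.mem_insert_self _ _⟩⟩
    let θ' : L.Formula F := θ.restrictFreeVar
      (fun z => ⟨z.1, Finset.mem_insert_of_mem z.2⟩)
    have hθ' : ∀ {N : Type w} [L.Structure N] (x : I ⊕ Unit → N),
        θ'.Realize (fun i => x i.1) ↔ θ.Realize x := by
      intro N _ x
      exact BoundedFormula.realize_restrictFreeVar (φ := θ) x (fun _ => rfl)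
    obtain ⟨k, hk1, hk⟩ := K.homog θ'
    let s : Finset I := F.preimage Sum.inl Sum.inl_injective.injOn
    have hs : ∀ i, Sum.inl i ∈ F → i ∈ s := fun i hi => Finset.mem_preimage.2 hi
    obtain ⟨pos, hpos1, hpos2⟩ : ∃ pos : (Finset I × ℕ) → ℕ,
        (¬ K.InP M' (cl fun t => K.c (pos t)) ∨
          ∃ i k, K.Clo M' k (cl fun t => K.c (pos t)) (a i)) ∧
        ∀ t : Finset I × ℕ, s ⊆ t.1 → 2 * k ≤ t.2 → k ≤ pos t ∧ ∀ i ∈ s,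
          (K.Bel M' (x0 n) (a i) → pos t + k ≤ spv t i) ∧
          (K.Bel M' (a i) (x0 n) → spv t i + k ≤ pos t) := by
      have hle : ∀ i j, K.Bel M' (a i) (x0 n) → K.Bel M' (x0 n) (a j) → i < j := by
        intro i j h1 h2
        rcases lt_trichotomy i j with h | h | h
        · exact h
        · subst h
          exact (hlin.below_irr (hlin.below_trans h1 h2)).elim
        · exact (hlin.below_irr (hlin.below_trans (haB j i h) (hlin.below_trans h1 h2))).elim
      let s' := s.filter (fun i => K.Bel M' (a i) (x0 n))
      by_cases hne : s'.Nonempty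
      · let m := s'.max' hne
        have hm := Finset.mem_filter.1 (s'.max'_mem hne)
        refine ⟨fun t => spv t m + k, Or.inr ⟨m, k + 1, ?_, ?_⟩, ?_⟩
        · rw [los2]
          intro h
          obtain ⟨t, ht⟩ := h.exists
          rw [K.G_c] at ht
          beta_reduce at ht
          omega
        · rw [los2]
          intro h
          obtain ⟨t, ht⟩ := h.exists
          rw [K.G_c] at ht
          beta_reduce at ht
          omega
        · intro t ht1 ht2
          refine ⟨Nat.le_add_left _ _, fun i hi => ⟨fun h => ?_, fun h => ?_⟩⟩
          · have : spv t m + t.2 ≤ spv t i := spv_lt t (ht1 hm.1) (hle _ _ hm.2 h)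
            show spv t m + k + k ≤ _
            omega
          · have h1 : i ≤ m := s'.le_max' i (Finset.mem_filter.2 ⟨hi, h⟩)
            rcases h1.lt_or_eq with h2 | h2
            · have := spv_lt t (ht1 hi) h2
              show _ ≤ spv t m + k
              omega
            · rw [h2]
      · refine ⟨fun t => k, Or.inl fun h => ?_, ?_⟩
        · have h1 := h _ (K.ev_hF (k + 1))
          rw [los1] at h1
          obtain ⟨t, ht⟩ := h1.exists
          rw [realize_hF, K.H_c] at ht
          beta_reduce at ht
          omega
        · intro t ht1 ht2
          refine ⟨le_rfl, fun i hi => ⟨fun h => ?_, fun h => ?_⟩⟩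
          · have := spv_ge t i
            show k + k ≤ _
            omega
          · exact (hne ⟨i, Finset.mem_filter.2 ⟨hi, h⟩⟩).elim
    have hreal : θ.Realize (Sum.elim a fun _ => cl fun t => K.c (pos t)) := by
      have h1 := los θ (Sum.elim (fun i t => K.c (spv t i)) fun _ t => K.c (pos t))
      have h2 : (fun i => cl (Sum.elim (fun i t => K.c (spv t i))
          (fun (_ : Unit) t => K.c (pos t)) i)) =
          Sum.elim a fun _ => cl fun t => K.c (pos t) := by
        funext i
        rcases i with i | i <;> rfl
      rw [h2] at h1
      rw [h1]
      filter_upwards [evs s (2 * k)] with t ht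
      obtain ⟨hp1, hp2⟩ := hpos2 t ht.1 ht.2
      have h3 := hk (N := M') (fun i : F => Sum.elim a (fun _ => x0 n) i.1)
        (fun i : F => Sum.elim (spv t) (fun _ => pos t) i.1) ?_ ?_ ?_
        ((hθ' _).2 ((hθ _).2 ⟨x0, hx0, rfl⟩))
      · have h4 := (hθ' (fun i => K.c (Sum.elim (spv t) (fun _ => pos t) i))).1 h3
        convert h4 using 1
        funext i
        rcases i with i | i <;> rfl
      · refine ⟨?_, ?_⟩
        · rintro ⟨i | i, hi⟩
          · have := spv_ge t i
            show k ≤ spv t i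
            omega
          · exact hp1
        · rintro ⟨i | i, hi⟩ ⟨j | j, hj⟩ hij
          · have hne : i ≠ j := fun h => hij (by subst h; rfl)
            show spv t i + k ≤ spv t j ∨ spv t j + k ≤ spv t i
            rcases lt_or_gt_of_ne hne with h | h
            · have := spv_lt t (ht.1 (hs i hi)) h
              omega
            · have := spv_lt t (ht.1 (hs j hj)) h
              omega
          · exact ((hyF' i).imp (hp2 i (hs i hi)).1 (hp2 i (hs i hi)).2).symm
          · exact (hyF' j).imp (hp2 j (hs j hj)).1 (hp2 j (hs j hj)).2
          · exact (hij rfl).elim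
      · rintro ⟨i | i, hi⟩
        · exact haP i
        · exact hyP
      · rintro ⟨i | i, hi⟩ ⟨j | j, hj⟩ hij
        · have hij' : spv t i < spv t j := hij
          refine haB i j ?_
          rcases lt_trichotomy i j with h | h | h
          · exact h
          · subst h; omega
          · have := spv_lt t (ht.1 (hs j hj)) h
            omega
        · have hij' : spv t i < pos t := hij
          refine (hyF' i).resolve_left fun h => ?_
          have := (hp2 i (hs i hi)).1 h
          omega
        · have hij' : pos t < spv t j := hij
          refine (hyF' j).resolve_right fun h => ?_
          have := (hp2 j (hs j hj)).2 h
          omega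
        · exact (lt_irrefl _ hij).elim
    obtain ⟨x, h1, h2⟩ := (hθ _).1 hreal
    exact ⟨x, h1, h2 ▸ hpos1⟩
  obtain ⟨N, _, b, hNc, hb, hom⟩ := omit_types hL a (K.gam I) main
  have hNne : Nonempty N := ⟨b (Classical.arbitrary I)⟩
  refine ⟨N, inferInstance, b, hNc, hNne, ?_, ?_, ?_, ?_⟩
  · intro φ x hx y
    have h1 := htr φ x hx
    have h2 := hb (φ.relabel Empty.elim) (by
      rw [Formula.realize_relabel]
      exact h1 _)
    rw [Formula.realize_relabel] at h2
    rw [Subsingleton.elim y (b ∘ Empty.elim)]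
    exact h2
  · intro i φ hφ
    have h2 := hb (φ.relabel fun _ => i) (by
      rw [realize_rel1]
      exact haP i φ hφ)
    rw [realize_rel1] at h2
    exact h2
  · intro i j hij k
    have h2 := hb ((gF K.dF K.ltF k).relabel ![i, j]) (by
      rw [realize_gF']
      exact haB i j hij k)
    rw [realize_gF'] at h2
    exact h2
  · intro y hy
    exact ((K.gam_iff b y).1 (hom y)).resolve_left (fun h => h hy)

end Core

end Model

section Iso

variable {L : FirstOrder.Language.{u, v}} {M : Type w} [L.Structure M] (K : Core L M)

/-- The model `N` is spread along `I`. -/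
structure Core.Good {I : Type} [LinearOrder I] {N : Type} [L.Structure N] (b : I → N) :
    Prop where
  lin : Lin (rel2 K.ltF N) (rel1 K.dF N)
  inP : ∀ i, K.InP N (b i)
  bel : ∀ i j, i < j → K.Bel N (b i) (b j)
  cov : ∀ y, K.InP N y → ∃ i k, K.Clo N k y (b i)

variable {K}

theorem Core.Good.lt {I : Type} [LinearOrder I] {N : Type} [L.Structure N] {b : I → N}
    (h : K.Good b) {i j : I} (hb : K.Bel N (b i) (b j)) : i < j := by
  rcases lt_trichotomy i j with h1 | h1 | h1
  · exact h1
  · subst h1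
    exact (h.lin.below_irr hb).elim
  · exact (h.lin.below_irr (h.lin.below_trans hb (h.bel _ _ h1))).elim

theorem iso_rel1 {N N' : Type} [L.Structure N] [L.Structure N'] (e : N ≃[L] N')
    (φ : L.Formula (Fin 1)) (x : N) : rel1 φ N' (e x) ↔ rel1 φ N x := by
  unfold rel1
  rw [← StrongHomClass.realize_formula e φ]
  rfl

theorem iso_GR {N N' : Type} [L.Structure N] [L.Structure N'] (e : N ≃[L] N') (k : ℕ)
    (x y : N) : GR (rel2 K.ltF N') (rel1 K.dF N') k (e x) (e y) ↔
      GR (rel2 K.ltF N) (rel1 K.dF N) k x y := by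
  rw [← realize_gF, ← realize_gF]
  unfold rel2
  rw [← StrongHomClass.realize_formula e]
  refine iff_of_eq (congrArg _ ?_)
  funext t
  fin_cases t <;> rfl

theorem iso_InP {N N' : Type} [L.Structure N] [L.Structure N'] (e : N ≃[L] N') {x : N}
    (h : K.InP N x) : K.InP N' (e x) := fun φ hφ => (iso_rel1 e φ x).2 (h φ hφ)

theorem Core.Good.iso {I J : Type} [LinearOrder I] [LinearOrder J] {N N' : Type}
    [L.Structure N] [L.Structure N'] {b : I → N} {b' : J → N'} (h : K.Good b)
    (h' : K.Good b') (e : N ≃[L] N') : Nonempty (I ≃o J) := by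
  choose g k hg using fun i => h'.cov (e (b i)) (iso_InP e (h.inP i))
  have eD : ∀ i, rel1 K.dF N' (e (b i)) := fun i => Core.InP.D K (iso_InP e (h.inP i))
  have bD : ∀ j, rel1 K.dF N' (b' j) := fun j => Core.InP.D K (h'.inP j)
  have hmono : StrictMono g := by
    intro i i' hii
    have h1 : K.Bel N' (e (b i)) (e (b i')) := fun l => (iso_GR e l _ _).2 (h.bel _ _ hii l)
    have h2 := h'.lin.below_left h1 (bD (g i)) (hg i)
    have h3 := h'.lin.below_right h2 (bD (g i')) (hg i')
    exact h'.lt h3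
  have hsurj : Function.Surjective g := by
    intro j
    obtain ⟨i, l, hi⟩ := h.cov (e.symm (b' j)) (iso_InP e.symm (h'.inP j))
    have hi' : K.Clo N' l (b' j) (e (b i)) := by
      refine ⟨fun h1 => hi.1 ?_, fun h1 => hi.2 ?_⟩
      · rw [← iso_GR e, e.apply_symm_apply]
        exact h1
      · rw [← iso_GR e, e.apply_symm_apply]
        exact h1
    refine ⟨i, ?_⟩
    rcases lt_trichotomy (g i) j with h1 | h1 | h1
    · have h2 := h'.lin.below_left (h'.bel _ _ h1) (eD i) ⟨(hg i).2, (hg i).1⟩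
      have h3 := h'.lin.below_right h2 (eD i) hi'
      exact (h'.lin.below_irr h3).elim
    · exact h1
    · have h2 := h'.lin.below_left (h'.bel _ _ h1) (eD i) hi'
      have h3 := h'.lin.below_right h2 (eD i) ⟨(hg i).2, (hg i).1⟩
      exact (h'.lin.below_irr h3).elim
  exact ⟨StrictMono.orderIsoOfSurjective g hmono hsurj⟩

end Iso

section Orders

/-- Sizes of the blocks. -/
noncomputable def blk (S : Set ℕ) (q : ℚ) : ℕ :=
  open Classical in if q.num.natAbs ∈ S then q.num.natAbs + 1 else 0

/-- Linear orders coding subsets of `ℕ`. -/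
abbrev Ord (S : Set ℕ) : Type := {x : ℚ ×ₗ ℕ // (ofLex x).2 ≤ blk S (ofLex x).1}

/-- Elements at finite distance. -/
def fcls {X : Type*} [LinearOrder X] (x : X) : Set X :=
  {y | (Set.Icc x y).Finite ∧ (Set.Icc y x).Finite}

theorem fcls_iso {X Y : Type*} [LinearOrder X] [LinearOrder Y] (e : X ≃o Y) (x : X) :
    (fcls (e x)).ncard = (fcls x).ncard := by
  have : fcls (e x) = e '' fcls x := by
    ext y
    obtain ⟨z, rfl⟩ := e.surjective y
    rw [e.injective.mem_set_image]
    unfold fcls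
    simp only [Set.mem_setOf_eq]
    rw [← e.image_Icc, ← e.image_Icc, Set.finite_image_iff e.injective.injOn,
      Set.finite_image_iff e.injective.injOn]
  rw [this, Set.ncard_image_of_injective _ e.injective]

theorem Ord.icc_inf {S : Set ℕ} {x y : Ord S} (h : (ofLex x.1).1 < (ofLex y.1).1) :
    (Set.Icc x y).Infinite := by
  let f : ℚ → Ord S := fun q => ⟨toLex (q, 0), Nat.zero_le _⟩
  have hf : Function.Injective f := by
    intro p q hpq
    have := congrArg (fun z : Ord S => (ofLex z.1).1) hpq
    exact this
  refine ((Set.Ioo_infinite h).image hf.injOn).mono ?_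
  rintro _ ⟨q, ⟨h1, h2⟩, rfl⟩
  refine ⟨?_, ?_⟩
  · exact Prod.Lex.le_iff.2 (Or.inl h1)
  · exact Prod.Lex.le_iff.2 (Or.inl h2)

theorem Ord.fib_eq {S : Set ℕ} (q : ℚ) : {y : Ord S | (ofLex y.1).1 = q} =
    Set.range (fun k : Fin (blk S q + 1) =>
      (⟨toLex (q, k.1), Nat.le_of_lt_succ k.2⟩ : Ord S)) := by
  ext y
  constructor
  · rintro rfl
    exact ⟨⟨(ofLex y.1).2, Nat.lt_succ_of_le y.2⟩, rfl⟩
  · rintro ⟨k, rfl⟩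
    rfl

theorem Ord.fcls_eq {S : Set ℕ} (x : Ord S) :
    fcls x = {y | (ofLex y.1).1 = (ofLex x.1).1} := by
  have hfib : ∀ q : ℚ, {y : Ord S | (ofLex y.1).1 = q}.Finite := by
    intro q
    rw [Ord.fib_eq]
    exact Set.finite_range _
  ext y
  constructor
  · rintro ⟨h1, h2⟩
    by_contra h3
    rcases lt_or_gt_of_ne h3 with h | h
    · exact icc_inf h h2
    · exact icc_inf h h1
  · intro h
    have key : ∀ x y : Ord S, (ofLex y.1).1 = (ofLex x.1).1 → (Set.Icc x y).Finite := by
      intro x y h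
      refine (hfib (ofLex x.1).1).subset ?_
      rintro z ⟨h1, h2⟩
      have h1' : (ofLex x.1).1 ≤ (ofLex z.1).1 := Prod.Lex.monotone_fst _ _ h1
      have h2' : (ofLex z.1).1 ≤ (ofLex y.1).1 := Prod.Lex.monotone_fst _ _ h2
      exact le_antisymm (h2'.trans h.le) h1'
    exact ⟨key x y h, key y x h.symm⟩

theorem Ord.ncard {S : Set ℕ} (x : Ord S) : (fcls x).ncard = blk S (ofLex x.1).1 + 1 := by
  rw [Ord.fcls_eq, Ord.fib_eq, ← Nat.card_coe_set_eq, Nat.card_range_of_injective, Nat.card_fin]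
  intro k l hkl
  have := congrArg (fun z : Ord S => (ofLex z.1).2) hkl
  exact Fin.ext this

theorem Ord.mem_iff (S : Set ℕ) (n : ℕ) : n ∈ S ↔ ∃ x : Ord S, (fcls x).ncard = n + 2 := by
  constructor
  · intro h
    refine ⟨⟨toLex ((n : ℚ), 0), Nat.zero_le _⟩, ?_⟩
    rw [Ord.ncard]
    simp [blk, h]
  · rintro ⟨x, hx⟩
    rw [Ord.ncard] at hx
    unfold blk at hx
    split_ifs at hx with h
    · have : (ofLex x.1).1.num.natAbs = n := by omega
      exact this ▸ h
    · omega

theorem Ord.inj {S T : Set ℕ} (e : Ord S ≃o Ord T) : S = T := by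
  ext n
  rw [Ord.mem_iff, Ord.mem_iff]
  constructor
  · rintro ⟨x, hx⟩
    exact ⟨e x, (fcls_iso e x).trans hx⟩
  · rintro ⟨x, hx⟩
    exact ⟨e.symm x, (fcls_iso e.symm x).trans hx⟩

instance (S : Set ℕ) : Nonempty (Ord S) := ⟨⟨toLex (0, 0), Nat.zero_le _⟩⟩

instance (S : Set ℕ) : Countable (Ord S) := by
  have : Countable (ℚ ×ₗ ℕ) := inferInstanceAs (Countable (ℚ × ℕ))
  infer_instance

end Orders

section Extract

variable {L : FirstOrder.Language.{u, v}} {M : Type w} [L.Structure M]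

theorem enum_omega {X : Type*} {r : X → X → Prop} {C D : Set X} (hC : C ⊆ D)
    (hlin : (∀ a ∈ D, ¬r a a) ∧ (∀ a ∈ D, ∀ b ∈ D, ∀ c ∈ D, r a b → r b c → r a c) ∧
      (∀ a ∈ D, ∀ b ∈ D, a = b ∨ r a b ∨ r b a))
    (hinf : C.Infinite) (hfin : ∀ c ∈ C, {c' ∈ C | r c' c}.Finite) :
    ∃ c : ℕ → X, (∀ m n, r (c m) (c n) ↔ m < n) ∧ Set.range c = C := by
  obtain ⟨h1, h2, h3⟩ := hlin
  let rk : C → ℕ := fun c => {c' ∈ C | r c' c}.ncard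
  have hrk : ∀ a b : C, r a b → rk a < rk b := by
    intro a b hab
    refine Set.ncard_lt_ncard ?_ (hfin b b.2)
    refine (Set.ssubset_iff_of_subset ?_).2 ⟨a, ⟨a.2, hab⟩, fun h => h1 _ (hC a.2) h.2⟩
    rintro z ⟨hz, hza⟩
    exact ⟨hz, h2 _ (hC hz) _ (hC a.2) _ (hC b.2) hza hab⟩
  have hrk' : ∀ a b : C, r a b ↔ rk a < rk b := by
    intro a b
    refine ⟨hrk a b, fun h => ?_⟩
    rcases h3 a (hC a.2) b (hC b.2) with h4 | h4 | h4
    · rw [Subtype.ext h4] at h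
      exact (lt_irrefl _ h).elim
    · exact h4
    · exact (lt_asymm h (hrk b a h4)).elim
  have hinj : Function.Injective rk := by
    intro a b hab
    rcases h3 a (hC a.2) b (hC b.2) with h4 | h4 | h4
    · exact Subtype.ext h4
    · exact absurd hab (hrk a b h4).ne
    · exact absurd hab (hrk b a h4).ne'
  have : Infinite C := hinf.to_subtype
  have hS : (Set.range rk).Infinite := Set.infinite_range_of_injective hinj
  have : Infinite (Set.range rk) := hS.to_subtype
  classical
  let o := Nat.Subtype.orderIsoOfNat (Set.range rk)
  choose d hd using fun n => (o n).2
  refine ⟨fun n => (d n : X), fun m n => ?_, ?_⟩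
  · rw [hrk', hd, hd]
    show o m < o n ↔ _
    exact o.lt_iff_lt
  · ext x
    constructor
    · rintro ⟨n, rfl⟩
      exact (d n).2
    · intro hx
      refine ⟨o.symm ⟨rk ⟨x, hx⟩, _, rfl⟩, ?_⟩
      have h5 := hd (o.symm ⟨rk ⟨x, hx⟩, _, rfl⟩)
      rw [o.apply_symm_apply] at h5
      have := hinj h5
      exact congrArg Subtype.val this

end Extract

section Upper

variable {L : FirstOrder.Language.{u, v}}

theorem iso_of_code {N N' : Type} [L.Structure N] [L.Structure N'] (g : ℕ ≃ N) (g' : ℕ ≃ N')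
    (h : ∀ φ : L.Formula ℕ, φ.Realize g ↔ φ.Realize g') : Nonempty (N ≃[L] N') := by
  refine ⟨⟨g.symm.trans g', ?_, ?_⟩⟩
  · intro n f x
    have h1 := (h (Term.equal (Term.func f fun k => Term.var (g.symm (x k)))
      (Term.var (g.symm (Structure.funMap f x))))).1 (by
        rw [Formula.realize_equal]
        simp)
    rw [Formula.realize_equal] at h1
    exact h1.symm
  · intro n r x
    have h1 := h (r.formula fun k => Term.var (g.symm (x k)))
    rw [Formula.realize_rel, Formula.realize_rel] at h1
    simp only [Term.realize_var, Equiv.apply_symm_apply] at h1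
    exact h1.symm

end Upper

section Final

/-- Formulas over the empty set. -/
def dropE {L : FirstOrder.Language.{u, v}} {M : Type w} {n : ℕ}
    (φ : L.Formula (↥(∅ : Set M) ⊕ Fin n)) : L.Formula (Fin n) :=
  φ.relabel (Sum.elim (fun a => a.2.elim) id)

theorem realize_dropE {L : FirstOrder.Language.{u, v}} {M : Type w} [L.Structure M] {n : ℕ}
    (φ : L.Formula (↥(∅ : Set M) ⊕ Fin n)) (x : Fin n → M) :
    (dropE φ).Realize x ↔ φ.Realize (pval x) := by
  unfold dropE
  rw [Formula.realize_relabel]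
  refine iff_of_eq (congrArg _ ?_)
  funext t
  rcases t with t | t
  · exact t.2.elim
  · rfl

theorem exists_core {L : FirstOrder.Language.{u, v}} {M : Type w} [L.Structure M]
    {p : Set (L.Formula (↥(∅ : Set M) ⊕ Fin 1))} {C : Set M}
    {δ : L.Formula (↥(∅ : Set M) ⊕ Fin 1)} {lt : L.Formula (↥(∅ : Set M) ⊕ Fin 2)}
    (hp : IsSimpleWitness (∅ : Set M) p C δ lt) : Nonempty (Core L M) := by
  obtain ⟨⟨_, hcomp⟩, hinf, hdcl, hlin, ⟨hCD, hseg⟩, ⟨_, hfin⟩, huniq⟩ := hp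
  obtain ⟨c, hc, hrange⟩ := enum_omega hCD hlin hinf hfin
  have vec1 : ∀ x : M, (fun _ : Fin 1 => x) = ![x] := by
    intro x
    funext t
    fin_cases t
    rfl
  let dF : L.Formula (Fin 1) := dropE δ
  let ltF : L.Formula (Fin 2) := dF.relabel (fun _ => 0) ⊓ (dF.relabel (fun _ => 1) ⊓ dropE lt)
  have hd : ∀ x, rel1 dF M x ↔ x ∈ defSet ∅ δ := by
    intro x
    unfold rel1
    rw [realize_dropE, vec1]
    rfl
  have hl : ∀ x y, rel2 ltF M x y ↔ gRel ∅ δ lt x y := by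
    intro x y
    unfold rel2
    rw [Formula.realize_inf, Formula.realize_inf, realize_rel1, realize_rel1, realize_dropE, hd, hd]
    rfl
  have cC : ∀ n, c n ∈ C := fun n => hrange ▸ Set.mem_range_self n
  have cinj : Function.Injective c := by
    intro m n hmn
    rcases lt_trichotomy m n with h | h | h
    · have h1 := (hc m n).2 h
      rw [hmn] at h1
      exact (hlin.1 _ (hCD (cC n)) h1).elim
    · exact h
    · have h1 := (hc n m).2 h
      rw [hmn] at h1
      exact (hlin.1 _ (hCD (cC n)) h1).elim
  have ev : ∀ φ : L.Formula (↥(∅ : Set M) ⊕ Fin 1), φ ∈ p →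
      ∀ᶠ n in Filter.atTop, φ.Realize (pval ![c n]) := by
    intro φ hφ
    have h1 := (huniq φ).1 hφ
    have h2 := h1.preimage (f := c) cinj.injOn
    rw [← Nat.cofinite_eq_atTop]
    refine Set.Finite.subset h2 ?_
    intro n hn
    exact ⟨cC n, hn⟩
  refine ⟨⟨dF, ltF, c, ⟨?_, ?_, ?_, ?_⟩, ?_, ?_, ?_, ?_⟩⟩
  · intro x hx
    rw [hl] at hx
    exact hlin.1 x hx.1 hx
  · intro x y z hxy hyz
    rw [hl] at hxy hyz ⊢
    exact hlin.2.1 x hxy.1 y hxy.2.1 z hyz.2.1 hxy hyz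
  · intro x y hxy
    rw [hl] at hxy
    rw [hd, hd]
    exact ⟨hxy.1, hxy.2.1⟩
  · intro x y hx hy
    rw [hd] at hx hy
    rw [hl, hl]
    exact hlin.2.2 x hx y hy
  · intro m n
    rw [hl]
    exact hc m n
  · intro y n h
    rw [hl] at h
    have := hseg _ (cC n) y h.1 h
    rw [← hrange] at this
    obtain ⟨m, hm⟩ := this
    exact ⟨m, hm.symm⟩
  · intro n
    obtain ⟨φ, h1, h2⟩ := hdcl (cC n)
    refine ⟨dropE φ, fun y => ?_⟩
    unfold rel1
    rw [realize_dropE, vec1]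
    exact ⟨h2 y, fun h => h ▸ h1⟩
  · intro φ
    have key : ∀ x : M, (φ.relabel Sum.inr : L.Formula (↥(∅ : Set M) ⊕ Fin 1)).Realize
        (pval ![x]) ↔ rel1 φ M x := by
      intro x
      unfold rel1
      rw [Formula.realize_relabel, vec1]
      rfl
    rcases hcomp (φ.relabel Sum.inr) with h | h
    · exact Or.inl ((ev _ h).mono fun n hn => (key _).1 hn)
    · exact Or.inr ((ev _ h).mono fun n hn hn' => hn ((key _).2 hn'))

theorem exists_good {L : FirstOrder.Language.{u, v}} (hL : L.card ≤ ℵ₀)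
    (T : L.Theory) (hT : T.IsComplete) {M : Type w} [L.Structure M] (hMT : M ⊨ T)
    (hMinf : Infinite M) (K : Core L M) (S : Set ℕ) :
    ∃ (N : {N : Theory.ModelType.{u, v, 0} T // Countable N ∧ Infinite N}) (b : Ord S → N.1),
      K.Good b := by
  obtain ⟨N, _, b, h1, h2, h3, h4, h5, h6⟩ := K.exists_model hL (Ord S)
  have hee : M ≅[L] N := by
    rw [elementarilyEquivalent_iff]
    have h7 : ∀ φ : L.Sentence, M ⊨ φ → N ⊨ φ := fun φ hφ => h3 φ _ hφ _
    intro φ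
    refine ⟨h7 φ, fun h => ?_⟩
    by_contra h8
    exact (Sentence.realize_not N).1 (h7 φ.not ((Sentence.realize_not M).2 h8)) h
  have hNT : N ⊨ T := hee.theory_model_iff.1 hMT
  have hNinf : Infinite N := hee.infinite_iff.1 hMinf
  have hMne : Nonempty M := ⟨K.c 0⟩
  exact ⟨⟨Theory.ModelType.of T N, h1, hNinf⟩, b, ⟨transfer_lin h3 K.lin, h4, h5, h6⟩⟩

theorem upper_bound {L : FirstOrder.Language.{u, v}} (hL : L.card ≤ ℵ₀) (T : L.Theory) :
    ∃ f : Quotient (countableModelSetoid T) → Set ℕ, Function.Injective f := by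
  have hcnt := countable_formula hL ℕ
  obtain ⟨enc, henc⟩ := exists_injective_nat (L.Formula ℕ)
  have hg : ∀ N : {N : Theory.ModelType.{u, v, 0} T // Countable N ∧ Infinite N},
      Nonempty (ℕ ≃ N.1) := by
    intro N
    have := N.2.1
    have := N.2.2
    exact nonempty_equiv_of_countable
  let g := fun N => Classical.choice (hg N)
  refine ⟨fun q => enc '' {φ | φ.Realize (g q.out)}, fun q q' h => ?_⟩
  have h1 := henc.image_injective h
  have h2 := iso_of_code (g q.out) (g q'.out) fun φ => Set.ext_iff.1 h1 φ
  rw [← Quotient.out_eq q, ← Quotient.out_eq q']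
  exact Quotient.sound h2

end Final

/-- Theorem 2, counting part. If there exists a simple type
`p ∈ S₁(T)`, then `T` has exactly `2 ^ ℵ₀` countably infinite models. -/
theorem statement2 (L : FirstOrder.Language.{u, v}) (hL : L.card ≤ ℵ₀)
    (T : L.Theory) (hT : T.IsComplete)
    (M : Type w) [L.Structure M] (hMT : M ⊨ T) (hMinf : Infinite M)
    (hsat : IsAleph1Saturated L M)
    (p : Set (L.Formula (↥(∅ : Set M) ⊕ Fin 1))) (C : Set M)
    (δ : L.Formula (↥(∅ : Set M) ⊕ Fin 1)) (lt : L.Formula (↥(∅ : Set M) ⊕ Fin 2))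
    (hp : IsSimpleWitness (∅ : Set M) p C δ lt) :
    numCountableModels T = 2 ^ ℵ₀ := by
  obtain ⟨K⟩ := exists_core hp
  choose N b hNb using fun S => exists_good hL T hT hMT hMinf K S
  obtain ⟨f, hf⟩ := upper_bound hL T
  have hg : Function.Injective
      (fun S => (Quotient.mk (countableModelSetoid T) (N S))) := by
    intro S S' h
    obtain ⟨e⟩ := Quotient.exact h
    obtain ⟨o⟩ := (hNb S).iso (hNb S') e
    exact Ord.inj o
  obtain ⟨e, _⟩ := Function.Embedding.schroeder_bernstein hf hg
  have h1 := Cardinal.lift_mk_eq'.2 ⟨Equiv.ofBijective e ‹_›⟩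
  unfold numCountableModels
  simpa using h1

end PaperDef
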